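/- arXiv:0812.0733 — 2 statements merged into one kernel-verified Lean document; each statement's English description precedes it below -/
import Mathlib

section
/- The number of type B noncrossing partitions of {±1,...,±n} is the central binomial coefficient binomial(2n, n). -/
/-- A set partition of `{0, …, n-1}` is noncrossing if there is no quadruple
`a < b < c < d` with `a, c` in one block and `b, d` in a different block. -/
def IsNoncrossing {n : ℕ} (P : Finpartition (Finset.univ : Finset (Fin n))) : Prop :=
  ¬ ∃ (a b c d : Fin n) (B B' : Finset (Fin n)), a < b ∧ b < c ∧ c < d ∧
      B ∈ P.parts ∧ B' ∈ P.parts ∧ B ≠ B' ∧ a ∈ B ∧ c ∈ B ∧ b ∈ B' ∧ d ∈ B'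

/-- The antipodal map on `{0, …, 2n-1}` (representing `1, …, n, -1, …, -n` clockwise),
sending each symbol to its negative. -/
def antipode (n : ℕ) (x : Fin (2 * n)) : Fin (2 * n) :=
  ⟨(x.1 + n) % (2 * n), Nat.mod_lt _ (Nat.lt_of_le_of_lt (Nat.zero_le _) x.isLt)⟩

/-- Equivalence relations on `ℤ` that are noncrossing and invariant under translation by `n`. -/
def periodicNoncrossing (n : ℤ) : Set (Setoid ℤ) :=
  {r | (∀ i j, r (i + n) (j + n) ↔ r i j) ∧
    ∀ a b c d, a < b → b < c → c < d → r a c → r b d → r a b}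

/-- The equivalence relation cut out by a height function `h` on the integers and a height
function `g` on the gaps between them: two integers are related when they have the same height
and every gap between them is strictly higher. -/
def levelSetoid (h g : ℤ → ℤ) : Setoid ℤ where
  r i j := h i = h j ∧ ∀ k, min i j ≤ k → k < max i j → h i < g k
  iseqv := by
    refine ⟨fun i => ⟨rfl, fun k => by grind⟩, fun {i j} hij => ⟨hij.1.symm, fun k => ?_⟩,
      fun {i j l} hij hjl => ⟨hij.1.trans hjl.1, fun k => ?_⟩⟩
    · have := hij.1
      have := hij.2 k
      grind
    · have := hij.1
      have := hij.2 k
      have := hjl.2 k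
      grind

/-- The arc leaving `i` towards the right exists. -/
def HasRight (r : Setoid ℤ) (i : ℤ) : Prop := ∃ j, i < j ∧ r i j

/-- The arc arriving at `i + 1` from the left exists. -/
def SuccHasLeft (r : Setoid ℤ) (i : ℤ) : Prop := ∃ j, j ≤ i ∧ r j (i + 1)

/-- Left endpoints of the arcs passing strictly over `k`. -/
def arcsOver (r : Setoid ℤ) (k : ℤ) : Set ℤ :=
  {p | p < k ∧ (∃ q, k < q ∧ r p q) ∧ ∀ m, p < m → m ≤ k → ¬ r p m}

/-- Left endpoints of the arcs passing over the gap between `k` and `k + 1`. -/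
def arcsOverGap (r : Setoid ℤ) (k : ℤ) : Set ℤ :=
  {p | p ≤ k ∧ (∃ q, k < q ∧ r p q) ∧ ∀ m, p < m → m ≤ k → ¬ r p m}

section Arcs

variable {n : ℤ} {r : Setoid ℤ}

theorem arcsOverGap_finite (hn : 0 < n) (hr : r ∈ periodicNoncrossing n) (k : ℤ) :
    (arcsOverGap r k).Finite := by
  refine (Set.finite_Icc (k - n) k).subset fun p ⟨hp, ⟨q, hq, hpq⟩, hm⟩ => ⟨?_, hp⟩
  by_contra hlt
  exact hm (p + n) (by omega) (by omega)
    (hr.2 p (p + n) q (q + n) (by omega) (by omega) (by omega) hpq ((hr.1 _ _).2 hpq))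

theorem arcsOver_subset (r : Setoid ℤ) (k : ℤ) : arcsOver r k ⊆ arcsOverGap r k :=
  fun _ hp => ⟨hp.1.le, hp.2⟩

/-- Among the members of a class lying in an interval there is a last one. -/
theorem exists_last_related (r : Setoid ℤ) {i x k : ℤ} (hi : i ≤ k) (hx : r i x) :
    ∃ p, i ≤ p ∧ p ≤ k ∧ r p x ∧ ∀ m, p < m → m ≤ k → ¬ r p m := by
  obtain ⟨p, ⟨hpk, hpx⟩, hmax⟩ := Int.exists_greatest_of_bdd (P := fun p => p ≤ k ∧ r p x)
    ⟨k, fun z hz => hz.1⟩ ⟨i, hi, hx⟩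
  refine ⟨p, hmax i ⟨hi, hx⟩, hpk, hpx, fun m hpm hmk hr => ?_⟩
  have := hmax m ⟨hmk, r.trans' (r.symm' hr) hpx⟩
  omega

open Classical in
theorem ncard_arcsOverGap (hn : 0 < n) (hr : r ∈ periodicNoncrossing n) (k : ℤ) :
    ((arcsOverGap r k).ncard : ℤ) =
      (arcsOver r k).ncard + if HasRight r k then 1 else 0 := by
  have hfin := (arcsOverGap_finite hn hr k).subset (arcsOver_subset r k)
  split_ifs with h
  · have : arcsOverGap r k = insert k (arcsOver r k) := by
      ext p
      constructor
      · rintro ⟨h1, h2⟩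
        rcases h1.lt_or_eq with h1 | h1
        · exact Or.inr ⟨h1, h2⟩
        · exact Or.inl h1
      · rintro (rfl | hp)
        · exact ⟨le_rfl, h, fun m h1 h2 => by omega⟩
        · exact arcsOver_subset r k hp
    rw [this, Set.ncard_insert_of_notMem (fun hk => lt_irrefl _ hk.1) hfin]
    simp
  · have : arcsOverGap r k = arcsOver r k := by
      refine (arcsOver_subset r k).antisymm' fun p ⟨h1, h2⟩ => ⟨h1.lt_of_ne ?_, h2⟩
      rintro rfl
      exact h h2.1
    simp [this]

open Classical in
theorem ncard_arcsOver_succ (hn : 0 < n) (hr : r ∈ periodicNoncrossing n) (k : ℤ) :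
    ((arcsOver r (k + 1)).ncard : ℤ) =
      (arcsOverGap r k).ncard - if SuccHasLeft r k then 1 else 0 := by
  have hsub : arcsOver r (k + 1) ⊆ arcsOverGap r k := fun p ⟨h1, ⟨q, hq, hpq⟩, h3⟩ =>
    ⟨by omega, ⟨q, by omega, hpq⟩, fun m h4 h5 => h3 m h4 (by omega)⟩
  have hfin := (arcsOverGap_finite hn hr k).subset hsub
  have key : ∀ p ∈ arcsOverGap r k, ¬ r p (k + 1) → p ∈ arcsOver r (k + 1) := by
    rintro p ⟨h1, ⟨q, hq, hpq⟩, h3⟩ hnr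
    have hqk : q ≠ k + 1 := by rintro rfl; exact hnr hpq
    refine ⟨by omega, ⟨q, by omega, hpq⟩, fun m h4 h5 h6 => ?_⟩
    rcases h5.lt_or_eq with h5 | rfl
    · exact h3 m h4 (by omega) h6
    · exact hnr h6
  split_ifs with h
  · obtain ⟨j, hj, hjk⟩ := h
    obtain ⟨p, -, hpk, hp, hlast⟩ := exists_last_related r hj hjk
    have : arcsOverGap r k = insert p (arcsOver r (k + 1)) := by
      ext x
      constructor
      · intro hx
        by_cases hxr : r x (k + 1)
        · left
          have hxp : r x p := r.trans' hxr (r.symm' hp)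
          rcases lt_trichotomy x p with h | h | h
          · exact (hx.2.2 p h hpk hxp).elim
          · exact h
          · exact (hlast x h hx.1 (r.symm' hxp)).elim
        · exact Or.inr (key x hx hxr)
      · rintro (rfl | hx)
        · exact ⟨hpk, ⟨k + 1, by omega, hp⟩, hlast⟩
        · exact hsub hx
    rw [this, Set.ncard_insert_of_notMem (fun hk => hk.2.2 (k + 1) (by omega) le_rfl hp) hfin]
    simp
  · have : arcsOverGap r k = arcsOver r (k + 1) :=
      hsub.antisymm' fun p hp => key p hp fun hpr => h ⟨p, hp.1, hpr⟩
    simp [this]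

theorem ncard_arcsOver_add (hr : r ∈ periodicNoncrossing n) (k : ℤ) :
    (arcsOver r (k + n)).ncard = (arcsOver r k).ncard := by
  have : arcsOver r (k + n) = (fun p => p + n) '' arcsOver r k := by
    ext x
    constructor
    · rintro ⟨h1, ⟨q, hq, hxq⟩, h3⟩
      refine ⟨x - n, ⟨by omega, ⟨q - n, by omega, ?_⟩, fun m h4 h5 h6 => ?_⟩, by simp⟩
      · rw [← hr.1]; simpa using hxq
      · refine h3 (m + n) (by omega) (by omega) ?_
        rw [← hr.1] at h6; simpa using h6
    · rintro ⟨p, ⟨h1, ⟨q, hq, hpq⟩, h3⟩, rfl⟩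
      refine ⟨by simpa using h1, ⟨q + n, by omega, (hr.1 _ _).2 hpq⟩, fun m h4 h5 h6 => ?_⟩
      refine h3 (m - n) (by simp at h4; omega) (by omega) ?_
      rw [← hr.1]; simpa using h6
  rw [this, Set.ncard_image_of_injective _ (add_left_injective n)]

theorem arcsOver_subset_of_rel (hr : r ∈ periodicNoncrossing n) {i j : ℤ} (hij : i < j)
    (h : r i j) : arcsOver r i ⊆ arcsOver r j := by
  rintro p ⟨h1, ⟨q, hq, hpq⟩, h3⟩
  have hpi := h3 i h1 le_rfl
  have key : ∀ m, i < m → m ≤ j → ¬ r p m := by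
    intro m hm hmj hpm
    rcases hmj.lt_or_eq with hmj | rfl
    · exact hpi (hr.2 p i m j h1 hm hmj hpm h)
    · exact hpi (r.trans' hpm (r.symm' h))
  refine ⟨by omega, ⟨q, ?_, hpq⟩, fun m h4 h5 => ?_⟩
  · by_contra hqj
    exact key q hq (by omega) hpq
  · rcases le_or_gt m i with h6 | h6
    · exact h3 m h4 h6
    · exact key m h6 h5

theorem arcsOver_eq_of_rel (hr : r ∈ periodicNoncrossing n) {i j : ℤ} (hij : i < j)
    (h : r i j) : arcsOver r i = arcsOver r j := by
  refine (arcsOver_subset_of_rel hr hij h).antisymm ?_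
  rintro p ⟨h1, ⟨q, hq, hpq⟩, h3⟩
  have hpj := h3 j h1 le_rfl
  have hpi : p < i := by
    rcases lt_trichotomy p i with h4 | rfl | h4
    · exact h4
    · exact (hpj h).elim
    · exact (hpj (r.trans' (r.symm' (hr.2 i p j q h4 h1 hq h hpq)) h)).elim
  exact ⟨hpi, ⟨q, by omega, hpq⟩, fun m h4 h5 => h3 m h4 (by omega)⟩

/-- A periodic noncrossing relation is the level relation of its own arc counts. -/
theorem rel_iff_level_of_lt (hn : 0 < n) (hr : r ∈ periodicNoncrossing n) {i j : ℤ}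
    (hij : i < j) :
    r i j ↔ (arcsOver r i).ncard = (arcsOver r j).ncard ∧
      ∀ k, i ≤ k → k < j → (arcsOver r i).ncard < (arcsOverGap r k).ncard := by
  constructor
  · intro h
    refine ⟨by rw [arcsOver_eq_of_rel hr hij h], fun k hik hkj => ?_⟩
    refine Set.ncard_lt_ncard ?_ (arcsOverGap_finite hn hr k)
    obtain ⟨p, hip, hpk, hpj, hlast⟩ := exists_last_related r hik h
    have hsub : arcsOver r i ⊆ arcsOverGap r k := by
      intro x hx
      have hx' := arcsOver_subset_of_rel hr hij h hx
      exact ⟨by linarith [hx.1], hx'.2.1.imp fun q hq => ⟨by omega, hq.2⟩,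
        fun m h1 h2 => hx'.2.2 m h1 (by omega)⟩
    refine (Set.ssubset_iff_of_subset hsub).2 ⟨p, ⟨hpk, ⟨j, hkj, hpj⟩, hlast⟩, fun hp => ?_⟩
    exact absurd hp.1 (by omega)
  · rintro ⟨h1, h2⟩
    obtain ⟨p, hip, hpj, hpi, hlast⟩ := exists_last_related r hij.le (r.refl' i)
    rcases hpj.lt_or_eq with hpj | rfl
    swap
    · exact r.symm' hpi
    exfalso
    have hpeq : (arcsOver r p).ncard = (arcsOver r i).ncard := by
      rcases hip.lt_or_eq with h | rfl
      · rw [arcsOver_eq_of_rel hr h (r.symm' hpi)]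
      · rfl
    have hgap := h2 p hip hpj
    have hright : HasRight r p := by
      by_contra hno
      have := ncard_arcsOverGap hn hr p
      rw [if_neg hno] at this
      omega
    obtain ⟨q, hpq, hrpq⟩ := hright
    have hjq : j < q := by
      by_contra hle
      exact hlast q hpq (by omega) hrpq
    have hsub : arcsOver r p ⊂ arcsOver r j := by
      have hs : arcsOver r p ⊆ arcsOver r j := by
        intro x hx
        have hx' := arcsOver_subset_of_rel hr hpq hrpq hx
        exact ⟨by linarith [hx.1], hx'.2.1.imp fun q hq => ⟨by omega, hq.2⟩,
          fun m h1 h2 => hx'.2.2 m h1 (by omega)⟩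
      exact (Set.ssubset_iff_of_subset hs).2
        ⟨p, ⟨hpj, ⟨q, hjq, hrpq⟩, hlast⟩, fun hp => lt_irrefl _ hp.1⟩
    have := Set.ncard_lt_ncard hsub
      ((arcsOverGap_finite hn hr j).subset (arcsOver_subset r j))
    omega

theorem eq_levelSetoid (hn : 0 < n) (hr : r ∈ periodicNoncrossing n) :
    r = levelSetoid (fun i => (arcsOver r i).ncard) (fun i => (arcsOverGap r i).ncard) := by
  have key : ∀ i j, i < j → (r i j ↔ levelSetoid (fun i => (arcsOver r i).ncard)
      (fun i => (arcsOverGap r i).ncard) i j) := by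
    intro i j hij
    rw [rel_iff_level_of_lt hn hr hij]
    change _ ↔ (_ ∧ _)
    simp only [min_eq_left hij.le, max_eq_right hij.le, Nat.cast_inj, Nat.cast_lt]
  ext i j
  rcases lt_trichotomy i j with h | rfl | h
  · exact key i j h
  · exact ⟨fun _ => Setoid.refl' _ i, fun _ => r.refl' i⟩
  · exact ⟨fun h' => Setoid.symm' _ ((key j i h).1 (r.symm' h')),
      fun h' => r.symm' ((key j i h).2 (Setoid.symm' _ h'))⟩

end Arcs

section Words

open Finset

theorem Function.Periodic.map_emod {α : Type*} {f : ℤ → α} {n : ℤ} (hf : f.Periodic n) (i : ℤ) :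
    f (i % n) = f i := by
  rw [Int.emod_def, mul_comm]
  exact hf.sub_int_mul_eq (i / n)

theorem exists_height (d : ℤ → ℤ) : ∃ h : ℤ → ℤ, ∀ i, h (i + 1) = h i + d i := by
  refine ⟨fun i => ∑ k ∈ range i.toNat, d k - ∑ k ∈ range (-i).toNat, d (-(k : ℤ) - 1),
    fun i => ?_⟩
  rcases le_or_gt 0 i with hi | hi
  · lift i to ℕ using hi
    have h1 : (-((i : ℤ) + 1)).toNat = 0 := by omega
    have h2 : (-(i : ℤ)).toNat = 0 := by omega
    have h3 : ((i : ℤ) + 1).toNat = i + 1 := by omega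
    simp only [h1, h2, h3, sum_range_succ, range_zero, sum_empty, Int.toNat_natCast]
    ring
  · obtain ⟨m, rfl⟩ : ∃ m : ℕ, i = -(m : ℤ) - 1 := ⟨(-i - 1).toNat, by omega⟩
    have h1 : (-(m : ℤ) - 1 + 1).toNat = 0 := by omega
    have h2 : (-(m : ℤ) - 1).toNat = 0 := by omega
    have h3 : (-(-(m : ℤ) - 1 + 1)).toNat = m := by omega
    have h4 : (-(-(m : ℤ) - 1)).toNat = m + 1 := by omega
    simp only [h1, h2, h3, h4, sum_range_succ, range_zero, sum_empty]
    ring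

theorem eq_apply_zero_of_succ {u : ℤ → ℤ} (hu : ∀ i, u (i + 1) = u i) (i : ℤ) : u i = u 0 := by
  induction i using Int.induction_on with
  | zero => rfl
  | succ i ih => rw [hu, ih]
  | pred i ih => rw [← ih, ← hu]; simp

theorem sum_zmod_eq_sub {n : ℕ} [NeZero n] {h : ℤ → ℤ} {d : ZMod n → ℤ}
    (hd : ∀ i : ℤ, h (i + 1) = h i + d i) : ∑ x, d x = h n - h 0 := by
  have key : ∀ m : ℕ, ∑ k ∈ range m, d k = h m - h 0 := by
    intro m
    induction m with
    | zero => simp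
    | succ m ih =>
      rw [sum_range_succ, ih]
      push_cast
      rw [hd]
      push_cast
      ring
  rw [← key]
  symm
  refine sum_bij (fun k _ => (k : ZMod n)) (fun _ _ => mem_univ _) (fun a ha b hb hab => ?_)
    (fun x _ => ⟨x.val, mem_range.2 x.val_lt, by simp⟩) (fun _ _ => rfl)
  rw [ZMod.natCast_eq_natCast_iff] at hab
  exact hab.eq_of_lt_of_lt (mem_range.1 ha) (mem_range.1 hb)

variable {n : ℕ}

/-- Height increments encoded by a set of steps. -/
def wordStep (S : Finset (ZMod n ⊕ ZMod n)) (x : ZMod n) : ℤ :=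
  (if Sum.inl x ∈ S then 1 else 0) - if Sum.inr x ∈ S then 0 else 1

theorem sum_wordStep [NeZero n] (S : Finset (ZMod n ⊕ ZMod n)) :
    ∑ x, wordStep S x = (S.card : ℤ) - n := by
  have h1 : (S.card : ℤ) = ∑ x, if x ∈ S then 1 else 0 := by simp
  have h2 : (n : ℤ) = ∑ x : ZMod n, 1 := by simp [ZMod.card]
  rw [h1, h2, Fintype.sum_sum_type, add_sub_assoc, ← sum_sub_distrib, ← sum_add_distrib]
  refine sum_congr rfl fun x _ => ?_
  unfold wordStep
  split_ifs <;> rfl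

open Classical in
/-- The set of upward steps of a noncrossing relation. -/
noncomputable def arcWord (n : ℕ) [NeZero n] (r : Setoid ℤ) : Finset (ZMod n ⊕ ZMod n) :=
  {s | s.elim (fun x => HasRight r x.val) (fun x => ¬ SuccHasLeft r x.val)}

variable [NeZero n] {r : Setoid ℤ}

theorem inl_mem_arcWord (hr : r ∈ periodicNoncrossing n) (i : ℤ) :
    Sum.inl (i : ZMod n) ∈ arcWord n r ↔ HasRight r i := by
  have hp : Function.Periodic (HasRight r) (n : ℤ) := by
    refine fun i => propext ⟨?_, ?_⟩
    · rintro ⟨j, hj, hij⟩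
      exact ⟨j - n, by omega, (hr.1 _ _).1 (by simpa using hij)⟩
    · rintro ⟨j, hj, hij⟩
      exact ⟨j + n, by omega, (hr.1 _ _).2 hij⟩
  simp only [arcWord, mem_filter, mem_univ, true_and, Sum.elim_inl, ZMod.val_intCast]
  rw [hp.map_emod]

theorem inr_mem_arcWord (hr : r ∈ periodicNoncrossing n) (i : ℤ) :
    Sum.inr (i : ZMod n) ∈ arcWord n r ↔ ¬ SuccHasLeft r i := by
  have hp : Function.Periodic (SuccHasLeft r) (n : ℤ) := by
    refine fun i => propext ⟨?_, ?_⟩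
    · rintro ⟨j, hj, hij⟩
      refine ⟨j - n, by omega, (hr.1 _ _).1 ?_⟩
      rwa [sub_add_cancel, add_right_comm]
    · rintro ⟨j, hj, hij⟩
      refine ⟨j + n, by omega, ?_⟩
      rw [add_right_comm]
      exact (hr.1 _ _).2 hij
  simp only [arcWord, mem_filter, mem_univ, true_and, Sum.elim_inr, ZMod.val_intCast]
  rw [hp.map_emod]

theorem ncard_arcsOverGap_eq (hr : r ∈ periodicNoncrossing n) (i : ℤ) :
    ((arcsOverGap r i).ncard : ℤ) =
      (arcsOver r i).ncard + if Sum.inl (i : ZMod n) ∈ arcWord n r then 1 else 0 := by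
  rw [ncard_arcsOverGap (by exact_mod_cast Nat.pos_of_neZero n) hr]
  congr 2
  exact propext (inl_mem_arcWord hr i).symm

theorem ncard_arcsOver_succ_eq (hr : r ∈ periodicNoncrossing n) (i : ℤ) :
    ((arcsOver r (i + 1)).ncard : ℤ) = (arcsOver r i).ncard + wordStep (arcWord n r) i := by
  rw [ncard_arcsOver_succ (by exact_mod_cast Nat.pos_of_neZero n) hr,
    ncard_arcsOverGap_eq hr, wordStep]
  have := inr_mem_arcWord hr i
  split_ifs <;> first | tauto | ring

theorem card_arcWord (hr : r ∈ periodicNoncrossing n) : (arcWord n r).card = n := by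
  have h1 := sum_wordStep (arcWord n r)
  rw [sum_zmod_eq_sub (h := fun i => (arcsOver r i).ncard) (ncard_arcsOver_succ_eq hr)] at h1
  have h2 := ncard_arcsOver_add hr 0
  rw [zero_add] at h2
  omega

theorem arcWord_injOn : Set.InjOn (arcWord n) (periodicNoncrossing n) := by
  intro r hr s hs hrs
  have hn : (0 : ℤ) < n := by exact_mod_cast Nat.pos_of_neZero n
  have hdiff : ∀ i, ((arcsOver r i).ncard : ℤ) - (arcsOver s i).ncard =
      (arcsOver r 0).ncard - (arcsOver s 0).ncard := by
    refine eq_apply_zero_of_succ (u := fun i =>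
      ((arcsOver r i).ncard : ℤ) - (arcsOver s i).ncard) fun i => ?_
    simp only [ncard_arcsOver_succ_eq hr, ncard_arcsOver_succ_eq hs, hrs]
    ring
  have hgap : ∀ i, ((arcsOverGap r i).ncard : ℤ) - (arcsOverGap s i).ncard =
      (arcsOver r 0).ncard - (arcsOver s 0).ncard := by
    intro i
    rw [ncard_arcsOverGap_eq hr, ncard_arcsOverGap_eq hs, hrs, ← hdiff i]
    ring
  rw [eq_levelSetoid hn hr, eq_levelSetoid hn hs]
  ext i j
  have h1 := hdiff i
  have h2 := hdiff j
  refine and_congr ?_ (forall_congr' fun k => ?_)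
  · constructor <;> intro h <;> linarith
  · have h3 := hgap k
    refine imp_congr_right fun _ => imp_congr_right fun _ => ?_
    constructor <;> intro h <;> linarith

theorem levelSetoid_mem {n : ℤ} {h g : ℤ → ℤ} (hh : ∀ i, h (i + n) = h i)
    (hg : ∀ i, g (i + n) = g i) (h1 : ∀ i, g i ≤ h i + 1) :
    levelSetoid h g ∈ periodicNoncrossing n := by
  refine ⟨fun i j => and_congr (by rw [hh, hh]) ⟨fun H k hk hk' => ?_, fun H k hk hk' => ?_⟩, ?_⟩
  · have := H (k + n) (by omega) (by omega)
    rwa [hh, hg] at this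
  · have := H (k - n) (by omega) (by omega)
    rw [← hg] at this
    rw [hh]
    simpa using this
  · rintro a b c d hab hbc hcd ⟨hac, hac'⟩ ⟨hbd, hbd'⟩
    have h3 := hac' b (by omega) (by omega)
    have h4 := hbd' c (by omega) (by omega)
    have h5 := h1 b
    have h6 := h1 c
    exact ⟨by omega, fun k hk hk' => hac' k (by omega) (by omega)⟩

theorem hasRight_levelSetoid {n : ℤ} (hn : 0 < n) {h g : ℤ → ℤ} (hh : ∀ i, h (i + n) = h i)
    (h1 : ∀ i, h i ≤ g i) (h2 : ∀ i, g i ≤ h (i + 1) + 1) (i : ℤ) :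
    HasRight (levelSetoid h g) i ↔ h i < g i := by
  constructor
  · rintro ⟨j, hij, H⟩
    exact H.2 i (by omega) (by omega)
  · intro H
    obtain ⟨j, ⟨hij, hj⟩, hmin⟩ := Int.exists_least_of_bdd (P := fun j => i < j ∧ h j ≤ h i)
      ⟨i, fun z hz => hz.1.le⟩ ⟨i + n, by omega, (hh i).le⟩
    have hgap : ∀ k, i ≤ k → k < j → h i < g k := by
      intro k hik hkj
      rcases hik.lt_or_eq with hik | rfl
      · by_contra hle
        have := hmin k ⟨hik, (h1 k).trans (not_lt.1 hle)⟩
        omega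
      · exact H
    refine ⟨j, hij, ?_, fun k hk hk' => hgap k (by omega) (by omega)⟩
    have h3 := hgap (j - 1) (by omega) (by omega)
    have h4 := h2 (j - 1)
    rw [sub_add_cancel] at h4
    omega

theorem succHasLeft_levelSetoid {n : ℤ} (hn : 0 < n) {h g : ℤ → ℤ} (hh : ∀ i, h (i + n) = h i)
    (h1 : ∀ i, g i ≤ h i + 1) (h2 : ∀ i, h (i + 1) ≤ g i) (i : ℤ) :
    SuccHasLeft (levelSetoid h g) i ↔ h (i + 1) < g i := by
  constructor
  · rintro ⟨j, hij, H⟩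
    rw [← H.1]
    exact H.2 i (by omega) (by omega)
  · intro H
    obtain ⟨j, ⟨hij, hj⟩, hmax⟩ := Int.exists_greatest_of_bdd
      (P := fun j => j ≤ i ∧ h j ≤ h (i + 1)) ⟨i, fun z hz => hz.1⟩
      ⟨i + 1 - n, by omega, by rw [← hh (i + 1 - n)]; simp⟩
    have hgap : ∀ k, j ≤ k → k ≤ i → h (i + 1) < g k := by
      intro k hjk hki
      rcases hki.lt_or_eq with hki | rfl
      · by_contra hle
        have := hmax (k + 1) ⟨by omega, (h2 k).trans (not_lt.1 hle)⟩
        omega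
      · exact H
    have h3 := hgap j le_rfl hij
    have h4 := h1 j
    have h5 : h j = h (i + 1) := by omega
    exact ⟨j, hij, h5, fun k hk hk' => h5 ▸ hgap k (by omega) (by omega)⟩

theorem arcWord_surjOn :
    Set.SurjOn (arcWord n) (periodicNoncrossing n) {S | S.card = n} := by
  intro S hS
  have hn : (0 : ℤ) < n := by exact_mod_cast Nat.pos_of_neZero n
  obtain ⟨h, hstep⟩ := exists_height fun i => wordStep S i
  have hper : ∀ i, h (i + n) = h i := by
    intro i
    have h1 := eq_apply_zero_of_succ (u := fun i => h (i + n) - h i) (fun i => by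
      simp only [add_right_comm i 1, hstep]
      simp) i
    have h2 := sum_zmod_eq_sub hstep
    have h3 : S.card = n := hS
    rw [sum_wordStep, h3] at h2
    simp only [zero_add] at h1
    linarith
  set g : ℤ → ℤ := fun i => h i + if Sum.inl (i : ZMod n) ∈ S then 1 else 0 with hg
  have hgper : ∀ i, g (i + n) = g i := by
    intro i
    simp [hg, hper]
  have hg_succ : ∀ i, g i = h (i + 1) + if Sum.inr (i : ZMod n) ∈ S then 0 else 1 := by
    intro i
    rw [hstep]
    simp only [hg, wordStep]
    ring
  have h1 : ∀ i, h i ≤ g i := fun i => by simp only [hg]; split_ifs <;> simp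
  have h2 : ∀ i, g i ≤ h i + 1 := fun i => by simp only [hg]; split_ifs <;> simp
  have h3 : ∀ i, h (i + 1) ≤ g i := fun i => by rw [hg_succ]; split_ifs <;> simp
  have h4 : ∀ i, g i ≤ h (i + 1) + 1 := fun i => by rw [hg_succ]; split_ifs <;> simp
  have hmem := levelSetoid_mem hper hgper h2
  refine ⟨levelSetoid h g, hmem, ?_⟩
  ext (x | x)
  · obtain ⟨i, rfl⟩ := ZMod.intCast_surjective x
    rw [inl_mem_arcWord hmem, hasRight_levelSetoid hn hper h1 h4]
    simp only [hg]
    split_ifs <;> simp_all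
  · obtain ⟨i, rfl⟩ := ZMod.intCast_surjective x
    rw [inr_mem_arcWord hmem, succHasLeft_levelSetoid hn hper h2 h3, hg_succ]
    split_ifs <;> simp_all

/-- There are `C(2n, n)` noncrossing equivalence relations on `ℤ` with period `n`. -/
theorem ncard_periodicNoncrossing (n : ℕ) [NeZero n] :
    (periodicNoncrossing n).ncard = Nat.choose (2 * n) n := by
  have hbij : Set.BijOn (arcWord n) (periodicNoncrossing n) {S | S.card = n} :=
    ⟨fun r hr => card_arcWord hr, arcWord_injOn, arcWord_surjOn⟩
  have hset : {S : Finset (ZMod n ⊕ ZMod n) | S.card = n} =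
      (powersetCard n (univ : Finset (ZMod n ⊕ ZMod n)) : Set _) := by
    ext S
    simp [mem_powersetCard]
  rw [hbij.ncard_eq, hset, Set.ncard_coe_finset, card_powersetCard, card_univ, Fintype.card_sum,
    ZMod.card, two_mul]

end Words

section Cyclic

/-- Equivalence relations on `ℤ` lifting the centrally symmetric noncrossing partitions of a
`2n`-gon. -/
def cyclicNoncrossing (n : ℤ) : Set (Setoid ℤ) :=
  {t | (∀ i, t i (i + 2 * n)) ∧ (∀ i j, t (i + n) (j + n) ↔ t i j) ∧
    ∀ a b c d, a < b → b < c → c < d → d < a + 2 * n → t a c → t b d → t a b}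

theorem Setoid.add_mul_of_periodic {r : Setoid ℤ} {n : ℤ} (hr : ∀ i j, r (i + n) (j + n) ↔ r i j)
    {a : ℤ} (ha : r a (a + n)) (k : ℤ) : r a (a + n * k) := by
  have hstep : ∀ k : ℤ, r (a + n * k) (a + n * (k + 1)) := by
    intro k
    induction k using Int.induction_on with
    | zero => simpa using ha
    | succ k ih => rw [← hr] at ih; convert ih using 1 <;> ring
    | pred k ih => rw [← hr]; convert ih using 1 <;> ring
  induction k using Int.induction_on with
  | zero => simp
  | succ k ih => exact r.trans' ih (hstep k)
  | pred k ih =>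
    have := hstep (-k - 1)
    rw [sub_add_cancel] at this
    exact r.trans' ih (r.symm' this)

variable {n : ℤ} {r t : Setoid ℤ}

theorem add_mul_iff (hr : r ∈ periodicNoncrossing n) (i j k : ℤ) :
    r (i + n * k) (j + n * k) ↔ r i j := by
  induction k using Int.induction_on with
  | zero => simp
  | succ k ih => rw [← ih, ← hr.1 (i + n * (k : ℤ))]; ring_nf
  | pred k ih => rw [← ih, ← hr.1 (i + n * (-(k : ℤ) - 1))]; ring_nf

/-- A class of a periodic noncrossing relation that is not contained in an open half turn is
invariant under translation. -/
theorem rel_add_of_le_abs (hr : r ∈ periodicNoncrossing n) (hn : 0 < n) {i j : ℤ} (h : r i j)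
    (hij : n ≤ |i - j|) : r i (i + n) := by
  have key : ∀ i j, r i j → i + n ≤ j → r i (i + n) := by
    intro i j h hij
    rcases hij.lt_or_eq with hlt | rfl
    · exact hr.2 i (i + n) j (j + n) (by omega) hlt (by omega) h ((hr.1 _ _).2 h)
    · exact h
  rcases le_or_gt i j with hle | hlt
  · rw [abs_of_nonpos (by omega)] at hij
    exact key i j h (by omega)
  · rw [abs_of_nonneg (by omega)] at hij
    have h1 := key j i (r.symm' h) (by omega)
    exact r.trans' (r.trans' h h1) ((hr.1 _ _).2 (r.symm' h))

/-- The relation induced on `ℤ` by a periodic noncrossing relation modulo `2n`. -/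
def foldSetoid (r : Setoid ℤ) (hr : r ∈ periodicNoncrossing n) : Setoid ℤ where
  r i j := ∃ k, r i (j + n * (2 * k))
  iseqv := by
    refine ⟨fun i => ⟨0, by simp⟩, ?_, ?_⟩
    · rintro i j ⟨k, hk⟩
      refine ⟨-k, r.symm' ?_⟩
      rw [← add_mul_iff hr _ _ (2 * k)]
      convert hk using 1
      ring
    · rintro i j l ⟨k, hk⟩ ⟨m, hm⟩
      rw [← add_mul_iff hr _ _ (2 * k)] at hm
      refine ⟨m + k, ?_⟩
      convert r.trans' hk hm using 1
      ring

theorem rel_of_fold (hr : r ∈ periodicNoncrossing n) {i : ℤ} (hi : r i (i + n)) {j : ℤ}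
    (h : foldSetoid r hr i j) : r i j := by
  obtain ⟨k, hk⟩ := h
  have := (add_mul_iff hr _ _ (2 * -k)).2 hk
  have h2 := Setoid.add_mul_of_periodic hr.1 hi (2 * -k)
  convert r.trans' h2 this using 1
  ring

theorem rel_iff_fold (hr : r ∈ periodicNoncrossing n) (hn : 0 < n) (i j : ℤ) :
    r i j ↔ foldSetoid r hr i j ∧ (|i - j| < n ∨ foldSetoid r hr i (i + n)) := by
  constructor
  · intro h
    refine ⟨⟨0, by simpa using h⟩, (lt_or_ge _ _).imp_right fun hle => ⟨0, ?_⟩⟩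
    simpa using rel_add_of_le_abs hr hn h hle
  · rintro ⟨h1, h2⟩
    by_cases hi : r i (i + n)
    · exact rel_of_fold hr hi h1
    rcases h2 with h2 | ⟨k, hk⟩
    · obtain ⟨k, hk⟩ := h1
      have h3 : |i - (j + n * (2 * k))| < n := by
        by_contra hle
        exact hi (rel_add_of_le_abs hr hn hk (not_lt.1 hle))
      have hk0 : k = 0 := by
        rw [abs_lt] at h2 h3
        have h4 : n * k < n * 1 := by linarith [h2.1, h2.2, h3.1, h3.2]
        have h5 : n * (-1) < n * k := by linarith [h2.1, h2.2, h3.1, h3.2]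
        have h6 := lt_of_mul_lt_mul_left h4 hn.le
        have h7 := lt_of_mul_lt_mul_left h5 hn.le
        omega
      simpa [hk0] using hk
    · refine (hi (rel_add_of_le_abs hr hn hk ?_)).elim
      rw [show i - (i + n + n * (2 * k)) = n * (-(1 + 2 * k)) by ring, abs_mul, abs_of_pos hn]
      have : 1 ≤ |(-(1 + 2 * k))| := Int.one_le_abs (by omega)
      nlinarith

theorem fold_cases (hr : r ∈ periodicNoncrossing n) (hn : 0 < n) {i j : ℤ} (hij : i < j)
    (hj : j < i + 2 * n) (h : foldSetoid r hr i j) : r i j ∨ r i (j - 2 * n) := by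
  by_cases hi : r i (i + n)
  · exact Or.inl (rel_of_fold hr hi h)
  obtain ⟨k, hk⟩ := h
  have h3 : |i - (j + n * (2 * k))| < n := by
    by_contra hle
    exact hi (rel_add_of_le_abs hr hn hk (not_lt.1 hle))
  rw [abs_lt] at h3
  have h4 : n * k < n * 1 := by linarith [h3.1, h3.2]
  have h5 : n * (-2) < n * k := by linarith [h3.1, h3.2]
  have h6 := lt_of_mul_lt_mul_left h4 hn.le
  have h7 := lt_of_mul_lt_mul_left h5 hn.le
  obtain rfl | rfl : k = 0 ∨ k = -1 := by omega
  · left; simpa using hk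
  · right; convert hk using 1; ring

theorem fold_mem (hr : r ∈ periodicNoncrossing n) (hn : 0 < n) :
    foldSetoid r hr ∈ cyclicNoncrossing n := by
  have hshift : ∀ i, foldSetoid r hr i (i + 2 * n) := fun i =>
    ⟨-1, by convert r.refl' i using 1; ring⟩
  have hle : ∀ i j, r i j → foldSetoid r hr i j := fun i j h => ⟨0, by simpa using h⟩
  refine ⟨hshift, fun i j => exists_congr fun k => by rw [add_right_comm, hr.1], ?_⟩
  intro a b c d hab hbc hcd hda hac hbd
  have h2 : ∀ i j, r i (j - 2 * n) → r (i + 2 * n) j := by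
    intro i j h
    have := (add_mul_iff hr _ _ 2).2 h
    convert this using 1 <;> ring
  rcases fold_cases hr hn (by omega) (by omega) hac with h | h <;>
    rcases fold_cases hr hn (by omega) (by omega) hbd with h' | h'
  · exact hle _ _ (hr.2 a b c d hab hbc hcd h h')
  · have := hr.2 (d - 2 * n) a b c (by omega) hab hbc (r.symm' h') h
    exact hle _ _ (r.trans' (r.symm' this) (r.symm' h'))
  · have := hr.2 b c d (a + 2 * n) hbc hcd hda h' (r.symm' (h2 _ _ h))
    exact Setoid.trans' _ (hshift a)
      (hle _ _ (r.trans' (h2 _ _ h) (r.symm' this)))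
  · have := hr.2 c d (a + 2 * n) (b + 2 * n) hcd hda (by omega) (r.symm' (h2 _ _ h))
      (r.symm' (h2 _ _ h'))
    have h3 := r.trans' (r.trans' (h2 _ _ h) this) (r.symm' (h2 _ _ h'))
    exact Setoid.trans' _ (hshift a) (Setoid.trans' _ (hle _ _ h3) (Setoid.symm' _ (hshift b)))

theorem rel_add_of_rel (ht : t ∈ cyclicNoncrossing n) {i j : ℤ} (hij : t i j)
    (hi : t i (i + n)) : t j (j + n) :=
  t.trans' (t.trans' (t.symm' hij) hi) ((ht.2.1 _ _).2 hij)

theorem rel_sub_iff (ht : t ∈ cyclicNoncrossing n) {i j : ℤ} : t (i - n) j ↔ t (i + n) j := by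
  have : t (i - n) (i + n) := by
    convert ht.1 (i - n) using 1
    ring
  exact ⟨t.trans' (t.symm' this), t.trans' this⟩

/-- A class containing three points that do not lie in an open half turn is centrally
symmetric. -/
theorem rel_add_of_wide (ht : t ∈ cyclicNoncrossing n) {i j k : ℤ} (hij : i < j) (hjk : j < k)
    (h1 : j < i + n) (h2 : k < j + n) (h3 : i + n ≤ k) (hi : t i j) (hj : t j k) :
    t i (i + n) := by
  have hik := t.trans' hi hj
  rcases h3.lt_or_eq with h3 | rfl
  · have h4 : t (k - n) (i + n) := (rel_sub_iff ht).2 ((ht.2.1 _ _).2 (t.symm' hik))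
    have h5 := ht.2.2 i (k - n) j (i + n) (by omega) (by omega) (by omega) (by omega) hi h4
    exact t.trans' h5 h4
  · exact hik

/-- The connected lift of a relation modulo `2n`. -/
def unfoldSetoid (t : Setoid ℤ) (ht : t ∈ cyclicNoncrossing n) (hn : 0 < n) : Setoid ℤ where
  r i j := t i j ∧ (|i - j| < n ∨ t i (i + n))
  iseqv := by
    refine ⟨fun i => ⟨t.refl' i, Or.inl (by simpa using hn)⟩, ?_, ?_⟩
    · rintro i j ⟨h1, h2⟩
      refine ⟨t.symm' h1, ?_⟩
      rw [abs_sub_comm]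
      exact h2.imp_right (rel_add_of_rel ht h1)
    · rintro i j k ⟨h1, h2⟩ ⟨h3, h4⟩
      refine ⟨t.trans' h1 h3, ?_⟩
      by_cases hi : t i (i + n)
      · exact Or.inr hi
      have h2 := h2.resolve_right hi
      have h4 := h4.resolve_right fun h => hi (rel_add_of_rel ht (t.symm' h1) h)
      left
      by_contra h5
      rw [abs_lt] at h2 h4 h5
      apply hi
      rcases lt_or_ge i j with hij | hij
      · exact rel_add_of_wide ht hij (by omega) (by omega) (by omega) (by omega) h1 h3
      · exact rel_add_of_rel ht (t.symm' (t.trans' h1 h3)) (rel_add_of_wide ht (i := k) (j := j)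
          (k := i) (by omega) (by omega) (by omega) (by omega) (by omega) (t.symm' h3)
          (t.symm' h1))

theorem unfold_mem (ht : t ∈ cyclicNoncrossing n) (hn : 0 < n) :
    unfoldSetoid t ht hn ∈ periodicNoncrossing n := by
  refine ⟨fun i j => ?_, ?_⟩
  · refine and_congr (ht.2.1 i j) (or_congr ?_ (ht.2.1 i (i + n)))
    rw [add_sub_add_right_eq_sub]
  rintro a b c d hab hbc hcd ⟨hac, hac'⟩ ⟨hbd, hbd'⟩
  rw [abs_lt] at hac' hbd'
  by_cases ha : t a (a + n)
  · refine ⟨?_, Or.inr ha⟩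
    by_cases hb : t b (b + n)
    · have hmul := Setoid.add_mul_of_periodic ht.2.1 hb (-((b - a) / n))
      have hmod : b + n * (-((b - a) / n)) = a + (b - a) % n := by
        rw [Int.emod_def]
        ring
      have h1 := Int.emod_nonneg (b - a) hn.ne'
      have h2 := Int.emod_lt_of_pos (b - a) hn
      rw [hmod] at hmul
      rcases h1.lt_or_eq with h1 | h1
      · refine t.trans' (ht.2.2 a (a + (b - a) % n) (a + n) (a + (b - a) % n + n) (by omega)
          (by omega) (by omega) (by omega) ha (rel_add_of_rel ht hmul hb)) (t.symm' hmul)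
      · rw [← h1, add_zero] at hmul
        exact t.symm' hmul
    · have h1 := hbd'.resolve_right hb
      have h2 := ht.2.2 b c d (c + n) hbc hcd (by omega) (by omega) hbd (rel_add_of_rel ht hac ha)
      exact t.trans' hac (t.symm' h2)
  · have h1 := hac'.resolve_right ha
    refine ⟨?_, Or.inl (abs_lt.2 (by omega))⟩
    by_cases hb : t b (b + n)
    · exact ht.2.2 a b c (b + n) hab hbc (by omega) (by omega) hac hb
    · have h2 := hbd'.resolve_right hb
      exact ht.2.2 a b c d hab hbc hcd (by omega) hac hbd

theorem rel_add_mul_two (ht : t ∈ cyclicNoncrossing n) (i k : ℤ) : t i (i + 2 * n * k) :=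
  Setoid.add_mul_of_periodic (fun i j => by
    rw [two_mul, ← add_assoc, ← add_assoc, ht.2.1, ht.2.1]) (ht.1 i) k

theorem fold_unfold (ht : t ∈ cyclicNoncrossing n) (hn : 0 < n) :
    foldSetoid (unfoldSetoid t ht hn) (unfold_mem ht hn) = t := by
  ext i j
  have hshift : ∀ k, t j (j + n * (2 * k)) := fun k => by
    convert rel_add_mul_two ht j k using 1
    ring
  constructor
  · rintro ⟨k, hk, -⟩
    exact t.trans' hk (t.symm' (hshift k))
  · intro h
    have h1 := Int.emod_nonneg (j - i + n) (by omega : 2 * n ≠ 0)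
    have h2 := Int.emod_lt_of_pos (j - i + n) (by omega : 0 < 2 * n)
    have h3 : j + n * (2 * -((j - i + n) / (2 * n))) = i - n + (j - i + n) % (2 * n) := by
      rw [Int.emod_def]
      ring
    have h4 := t.trans' h (hshift (-((j - i + n) / (2 * n))))
    refine ⟨-((j - i + n) / (2 * n)), h4, ?_⟩
    rw [h3] at h4 ⊢
    rcases h1.lt_or_eq with h1 | h1
    · exact Or.inl (abs_lt.2 (by omega))
    · rw [← h1, add_zero] at h4
      exact Or.inr (t.symm' ((rel_sub_iff ht).1 (t.symm' h4)))

theorem ncard_cyclicNoncrossing (hn : 0 < n) :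
    (periodicNoncrossing n).ncard = (cyclicNoncrossing n).ncard := by
  refine Set.ncard_congr foldSetoid (fun r hr => fold_mem hr hn) (fun r s hr hs hrs => ?_)
    fun t ht => ⟨unfoldSetoid t ht hn, unfold_mem ht hn, fold_unfold ht hn⟩
  ext i j
  rw [rel_iff_fold hr hn, rel_iff_fold hs hn, hrs]

end Cyclic

section Polygon

open Finset

variable {n : ℕ} [NeZero n]

/-- Reduction of integers to vertices of the `2n`-gon. -/
def vertex (n : ℕ) [NeZero n] (i : ℤ) : Fin (2 * n) :=
  ⟨(i % (2 * n : ℕ)).toNat, by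
    have hn := Nat.pos_of_neZero n
    have := Int.emod_lt_of_pos i (by omega : (0 : ℤ) < (2 * n : ℕ))
    omega⟩

theorem vertex_val (i : ℤ) : ((vertex n i : ℕ) : ℤ) = i % (2 * n : ℕ) := by
  have hn := Nat.pos_of_neZero n
  have := Int.emod_nonneg i (by omega : ((2 * n : ℕ) : ℤ) ≠ 0)
  simp only [vertex]
  omega

theorem vertex_eq_iff (i : ℤ) (x : Fin (2 * n)) : vertex n i = x ↔ i % (2 * n : ℕ) = (x : ℕ) := by
  rw [← vertex_val, Fin.ext_iff, Nat.cast_inj]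

theorem vertex_natCast (x : Fin (2 * n)) : vertex n (x : ℕ) = x := by
  rw [vertex_eq_iff]
  exact Int.emod_eq_of_lt (by omega) (by omega)

theorem vertex_add_two_mul (i : ℤ) : vertex n (i + 2 * n) = vertex n i := by
  rw [vertex_eq_iff, vertex_val]
  push_cast
  exact Int.add_emod_right i _

theorem vertex_add (i : ℤ) : vertex n (i + n) = antipode n (vertex n i) := by
  rw [vertex_eq_iff]
  simp only [antipode]
  push_cast
  rw [vertex_val]
  simp

theorem antipode_antipode (x : Fin (2 * n)) : antipode n (antipode n x) = x := by
  obtain ⟨i, rfl⟩ : ∃ i, vertex n i = x := ⟨_, vertex_natCast x⟩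
  rw [← vertex_add, ← vertex_add, add_assoc, ← two_mul, vertex_add_two_mul]

/-- The lift of a partition of the vertices of the `2n`-gon to the integers. -/
def partitionLift (P : Finpartition (univ : Finset (Fin (2 * n)))) : Setoid ℤ :=
  (Setoid.ker P.part).comap (vertex n)

theorem partitionLift_iff (P : Finpartition (univ : Finset (Fin (2 * n)))) (i j : ℤ) :
    partitionLift P i j ↔ P.part (vertex n i) = P.part (vertex n j) :=
  Iff.rfl

theorem partitionLift_injective :
    Function.Injective (partitionLift : Finpartition (univ : Finset (Fin (2 * n))) → _) := by
  intro P Q hPQ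
  have hpart : ∀ x, P.part x = Q.part x := by
    intro x
    ext y
    rw [P.mem_part_iff_part_eq_part (mem_univ _) (mem_univ _),
      Q.mem_part_iff_part_eq_part (mem_univ _) (mem_univ _), ← vertex_natCast x,
      ← vertex_natCast y, ← partitionLift_iff, ← partitionLift_iff, hPQ]
  have key : ∀ P Q : Finpartition (univ : Finset (Fin (2 * n))), (∀ x, P.part x = Q.part x) →
      P.parts ⊆ Q.parts := by
    intro P Q h B hB
    obtain ⟨x, hx⟩ := P.nonempty_of_mem_parts hB
    rw [← P.part_eq_of_mem hB hx, h]
    exact Q.part_mem.2 (mem_univ _)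
  exact Finpartition.ext ((key P Q hpart).antisymm (key Q P fun x => (hpart x).symm))

theorem part_antipode {n : ℕ} {P : Finpartition (univ : Finset (Fin (2 * n)))}
    (hP : ∀ B ∈ P.parts, B.image (antipode n) ∈ P.parts) {x y : Fin (2 * n)}
    (h : P.part x = P.part y) : P.part (antipode n x) = P.part (antipode n y) := by
  have hB := hP _ (P.part_mem.2 (mem_univ x))
  rw [P.part_eq_of_mem hB (mem_image_of_mem _ (P.mem_part (mem_univ x))),
    P.part_eq_of_mem hB (mem_image_of_mem _ (h ▸ P.mem_part (mem_univ y)))]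

theorem partitionLift_mem {P : Finpartition (univ : Finset (Fin (2 * n)))} (hnc : IsNoncrossing P)
    (hP : ∀ B ∈ P.parts, B.image (antipode n) ∈ P.parts) :
    partitionLift P ∈ cyclicNoncrossing n := by
  have hn := Nat.pos_of_neZero n
  set t := partitionLift P with ht
  have hshift : ∀ i, t i (i + 2 * n) := fun i => by
    rw [partitionLift_iff, vertex_add_two_mul]
  have hadd : ∀ i j, t (i + n) (j + n) ↔ t i j := by
    intro i j
    rw [partitionLift_iff, partitionLift_iff, vertex_add, vertex_add]
    refine ⟨fun h => ?_, part_antipode hP⟩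
    simpa only [antipode_antipode] using part_antipode hP h
  have hlin : ∀ a b c d : ℤ, 0 ≤ a → a < b → b < c → c < d → d < 2 * n → t a c → t b d → t a b := by
    intro a b c d h0 hab hbc hcd hd hac hbd
    by_contra hne
    have hlt : ∀ i j : ℤ, 0 ≤ i → i < j → j < 2 * n → vertex n i < vertex n j := by
      intro i j h1 h2 h3
      rw [Fin.lt_def, ← Nat.cast_lt (α := ℤ), vertex_val, vertex_val,
        Int.emod_eq_of_lt (by omega) (by push_cast; omega),
        Int.emod_eq_of_lt (by omega) (by push_cast; omega)]
      exact h2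
    refine hnc ⟨vertex n a, vertex n b, vertex n c, vertex n d, P.part (vertex n a),
      P.part (vertex n b), hlt _ _ h0 hab (by omega), hlt _ _ (by omega) hbc (by omega),
      hlt _ _ (by omega) hcd (by omega), P.part_mem.2 (mem_univ _), P.part_mem.2 (mem_univ _), hne,
      P.mem_part (mem_univ _), ?_, P.mem_part (mem_univ _), ?_⟩
    · exact (P.mem_part_iff_part_eq_part (mem_univ _) (mem_univ _)).2 hac.symm
    · exact (P.mem_part_iff_part_eq_part (mem_univ _) (mem_univ _)).2 hbd.symm
  have hwin : ∀ a b c d : ℤ, 0 ≤ a → a < 2 * n → a < b → b < c → c < d → d < a + 2 * n →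
      t a c → t b d → t a b := by
    intro a b c d h0 h1 hab hbc hcd hd hac hbd
    have hsub : ∀ i, t (i - 2 * n) i := fun i => by simpa using hshift (i - 2 * n)
    have hb := hsub b
    have hc := hsub c
    have hd' := hsub d
    by_cases hd2 : d < 2 * n
    · exact hlin a b c d h0 hab hbc hcd hd2 hac hbd
    by_cases hc2 : c < 2 * n
    · have hdb := t.trans' hd' (t.symm' hbd)
      have := hlin (d - 2 * n) a b c (by omega) (by omega) hab hbc hc2 hdb hac
      exact t.trans' (t.symm' this) hdb
    by_cases hb2 : b < 2 * n
    · have hca := t.trans' hc (t.symm' hac)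
      have hdb := t.trans' hd' (t.symm' hbd)
      have := hlin (c - 2 * n) (d - 2 * n) a b (by omega) (by omega) (by omega) (by omega) hb2
        hca hdb
      exact t.trans' (t.symm' hca) (t.trans' this hdb)
    · have hca := t.trans' hc (t.symm' hac)
      have hbd2 := t.trans' hb (t.trans' hbd (t.symm' hd'))
      have := hlin (b - 2 * n) (c - 2 * n) (d - 2 * n) a (by omega) (by omega) (by omega)
        (by omega) h1 hbd2 hca
      exact t.trans' (t.symm' hca) (t.trans' (t.symm' this) hb)
  refine ⟨hshift, hadd, ?_⟩
  intro a b c d hab hbc hcd hda hac hbd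
  have hmod : ∀ i k : ℤ, t i (i - 2 * n * k) := by
    intro i k
    have h1 := Setoid.add_mul_of_periodic (r := t) (n := 2 * n) (fun i j => by
      rw [two_mul, ← add_assoc, ← add_assoc, hadd, hadd]) (hshift i) (-k)
    convert h1 using 1
    ring
  have h1 := Int.emod_nonneg a (by omega : (2 * n : ℤ) ≠ 0)
  have h2 := Int.emod_lt_of_pos a (by omega : (0 : ℤ) < 2 * n)
  rw [Int.emod_def] at h1 h2
  set m := 2 * (n : ℤ) * (a / (2 * n)) with hm
  have hmod' : ∀ i, t i (i - m) := fun i => hmod i _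
  have := hwin (a - m) (b - m) (c - m) (d - m) h1 h2 (by omega) (by omega) (by omega) (by omega)
    (t.trans' (t.symm' (hmod' a)) (t.trans' hac (hmod' c)))
    (t.trans' (t.symm' (hmod' b)) (t.trans' hbd (hmod' d)))
  exact t.trans' (hmod' a) (t.trans' this (t.symm' (hmod' b)))

open Classical in
theorem exists_partitionLift_eq {t : Setoid ℤ} (ht : t ∈ cyclicNoncrossing n) :
    ∃ P : Finpartition (univ : Finset (Fin (2 * n))), (IsNoncrossing P ∧
      ∀ B ∈ P.parts, B.image (antipode n) ∈ P.parts) ∧ partitionLift P = t := by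
  have hn := Nat.pos_of_neZero n
  set P := Finpartition.ofSetoid (t.comap fun x : Fin (2 * n) => ((x : ℕ) : ℤ)) with hP
  have hmem : ∀ x y, y ∈ P.part x ↔ t (x : ℕ) (y : ℕ) := fun x y =>
    Finpartition.mem_part_ofSetoid_iff_rel
  have hmod : ∀ i : ℤ, t (i % (2 * n : ℕ)) i := by
    intro i
    have := rel_add_mul_two ht (i % (2 * n : ℕ)) (i / (2 * n : ℕ))
    push_cast at this ⊢
    rwa [Int.emod_add_mul_ediv] at this
  have hlift : partitionLift P = t := by
    ext i j
    rw [partitionLift_iff, ← P.mem_part_iff_part_eq_part (mem_univ _) (mem_univ _), hmem,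
      vertex_val, vertex_val]
    exact ⟨fun h => t.symm' (t.trans' (t.symm' (hmod j)) (t.trans' h (hmod i))),
      fun h => t.trans' (hmod j) (t.trans' (t.symm' h) (t.symm' (hmod i)))⟩
  have hpart : ∀ x y : Fin (2 * n), P.part x = P.part y ↔ t (x : ℕ) (y : ℕ) := by
    intro x y
    rw [← hlift, partitionLift_iff, vertex_natCast, vertex_natCast]
  refine ⟨P, ⟨?_, ?_⟩, hlift⟩
  · rintro ⟨a, b, c, d, B, B', hab, hbc, hcd, hB, hB', hne, ha, hc, hb, hd⟩
    rw [← P.part_eq_of_mem hB ha] at hc hne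
    rw [← P.part_eq_of_mem hB' hb] at hd hne
    refine hne ((hpart a b).2 (ht.2.2 _ _ _ _ (by exact_mod_cast hab) (by exact_mod_cast hbc)
      (by exact_mod_cast hcd) ?_ ((hmem _ _).1 hc) ((hmem _ _).1 hd)))
    omega
  · intro B hB
    obtain ⟨x, hx⟩ := P.nonempty_of_mem_parts hB
    have hanti : ∀ y z, P.part y = P.part z → P.part (antipode n y) = P.part (antipode n z) := by
      intro y z h
      rw [← vertex_natCast y, ← vertex_natCast z, ← vertex_add, ← vertex_add,
        ← partitionLift_iff, hlift, ht.2.1]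
      exact (hpart y z).1 h
    rw [← P.part_eq_of_mem hB hx]
    convert P.part_mem.2 (mem_univ (antipode n x)) using 1
    ext y
    rw [mem_image, P.mem_part_iff_part_eq_part (mem_univ _) (mem_univ _)]
    constructor
    · rintro ⟨z, hz, rfl⟩
      exact hanti _ _ ((P.mem_part_iff_part_eq_part (mem_univ _) (mem_univ _)).1 hz)
    · intro h
      refine ⟨antipode n y, ?_, antipode_antipode y⟩
      rw [P.mem_part_iff_part_eq_part (mem_univ _) (mem_univ _), hanti _ _ h, antipode_antipode]

end Polygon

/-- The number of type B noncrossing partitions of `{±1, …, ±n}` (noncrossing partitions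
of the `2n`-gon invariant under the antipodal map) is the central binomial coefficient
`C(2n, n)`. -/
theorem stmt_14 (n : ℕ) :
    {P : Finpartition (Finset.univ : Finset (Fin (2 * n))) |
        IsNoncrossing P ∧ ∀ B ∈ P.parts, B.image (antipode n) ∈ P.parts}.ncard =
      Nat.choose (2 * n) n := by
  rcases Nat.eq_zero_or_pos n with rfl | hn
  · have hparts : ∀ P : Finpartition (Finset.univ : Finset (Fin (2 * 0))), P.parts = ∅ :=
      fun P => P.parts_eq_empty_iff.2 rfl
    rw [Nat.choose_zero_right, Set.ncard_eq_one]
    refine ⟨⊥, Set.eq_singleton_iff_unique_mem.2 ⟨⟨?_, ?_⟩, fun P _ => ?_⟩⟩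
    · rintro ⟨a, -⟩
      exact absurd a.isLt (by simp)
    · intro B hB
      rw [hparts] at hB
      exact absurd hB (Finset.notMem_empty B)
    · exact Finpartition.ext ((hparts P).trans (hparts _).symm)
  · have : NeZero n := ⟨hn.ne'⟩
    rw [← ncard_periodicNoncrossing, ncard_cyclicNoncrossing (by exact_mod_cast hn)]
    exact Set.BijOn.ncard_eq ⟨fun P hP => partitionLift_mem hP.1 hP.2,
      partitionLift_injective.injOn, fun t ht => exists_partitionLift_eq ht⟩
end

section
/- The number of primitive parking functions of length n of type λ (a partition of n) equals the number of noncrossing partitions of {1,...,n} of type λ, namely n!/(m_λ·(n+1−ℓ(λ))!). -/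
/-- `f` is a parking function of length `n`: some rearrangement of it is
weakly increasing with `i`-th entry between `1` and `i` (1-indexed). -/
def IsParkingFunction (n : ℕ) (f : Fin n → ℕ) : Prop :=
  ∃ σ : Equiv.Perm (Fin n), Monotone (f ∘ σ) ∧ ∀ i : Fin n, 1 ≤ f (σ i) ∧ f (σ i) ≤ i.1 + 1

/-- `m_λ = ∏_i m_i(λ)!`, the product of factorials of multiplicities of parts. -/
def mfac (lam : Multiset ℕ) : ℕ := lam.toFinset.prod fun i => (lam.count i).factorial

/-- The type of a parking function: the multiset of (positive) multiplicities of its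
values. -/
def pfType (n : ℕ) (f : Fin n → ℕ) : Multiset ℕ :=
  ((Finset.Icc 1 n).val.map fun i => (Finset.univ.filter fun j => f j = i).card).filter
    (0 < ·)

section Content

/-- The sum of the first `k` entries of `c`, where the indices are read cyclically. -/
def partialSum {n : ℕ} (c : Fin (n + 1) → ℕ) (k : ℕ) : ℕ :=
  ∑ i ∈ Finset.range k, c (Fin.ofNat (n + 1) i)

/-- The number of times that `g` takes each of the values `0, …, n`. -/
def content {n : ℕ} (g : Fin n → ℕ) (i : Fin (n + 1)) : ℕ :=
  (Finset.univ.filter fun j => g j = i).card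

/-- The nonzero values of a vector, as a multiset. -/
def contentType {n : ℕ} (c : Fin (n + 1) → ℕ) : Multiset ℕ :=
  (Finset.univ.val.map c).filter (0 < ·)

/-- A vector of total `n` whose first `k` entries sum to at least `k`, for all `k ≤ n`. -/
def IsBallot {n : ℕ} (c : Fin (n + 1) → ℕ) : Prop :=
  partialSum c (n + 1) = n ∧ ∀ k ≤ n, k ≤ partialSum c k

variable {n : ℕ}

theorem partialSum_succ (c : Fin (n + 1) → ℕ) (k : ℕ) :
    partialSum c (k + 1) = partialSum c k + c (Fin.ofNat (n + 1) k) :=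
  Finset.sum_range_succ _ _

theorem partialSum_mono (c : Fin (n + 1) → ℕ) : Monotone (partialSum c) :=
  monotone_nat_of_le_succ fun k => by simp [partialSum_succ]

theorem partialSum_eq_sum_univ (c : Fin (n + 1) → ℕ) : partialSum c (n + 1) = ∑ i, c i := by
  rw [partialSum, Finset.sum_range]
  exact Finset.sum_congr rfl fun i _ => by simp

theorem eq_of_partialSum_eq {c d : Fin (n + 1) → ℕ}
    (h : ∀ k ≤ n + 1, partialSum c k = partialSum d k) : c = d := by
  funext i
  have h₁ := h i (by omega)
  have h₂ := h (i + 1) (by omega)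
  rw [partialSum_succ, partialSum_succ, h₁] at h₂
  simpa using h₂

theorem partialSum_content (g : Fin n → ℕ) {k : ℕ} (hk : k ≤ n + 1) :
    partialSum (content g) k = (Finset.univ.filter fun j => g j < k).card := by
  induction k with
  | zero => simp [partialSum]
  | succ k ih =>
    rw [partialSum_succ, ih (by omega), content, ← Finset.card_union_of_disjoint]
    · congr 1
      ext j
      simp only [Finset.mem_union, Finset.mem_filter, Finset.mem_univ, true_and, Fin.val_ofNat,
        Nat.mod_eq_of_lt (show k < n + 1 by omega)]
      omega
    · rw [Finset.disjoint_left]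
      intro j
      simp only [Finset.mem_filter, Finset.mem_univ, true_and, Fin.val_ofNat,
        Nat.mod_eq_of_lt (show k < n + 1 by omega)]
      omega

theorem IsBallot.partialSum_self {c : Fin (n + 1) → ℕ} (hc : IsBallot c) :
    partialSum c n = n := by
  have h₁ := hc.2 n le_rfl
  have h₂ := partialSum_mono c (Nat.le_succ n)
  have h₃ := hc.1
  simp only [Nat.succ_eq_add_one] at h₂
  omega

theorem isBallot_content {g : Fin n → ℕ} (hg : ∀ j, g j ≤ j) : IsBallot (content g) := by
  constructor
  · rw [partialSum_content g le_rfl, Finset.filter_true_of_mem, Finset.card_univ,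
      Fintype.card_fin]
    intro j _
    have := hg j
    omega
  · intro k hk
    rw [partialSum_content g (by omega)]
    calc k = (Finset.univ.filter fun j : Fin n => j.1 < k).card := by
          rw [Fin.card_filter_val_lt]; omega
      _ ≤ _ := Finset.card_le_card fun j => by
          simp only [Finset.mem_filter, Finset.mem_univ, true_and]
          have := hg j
          omega

theorem sum_contentType (c : Fin (n + 1) → ℕ) : (contentType c).sum = partialSum c (n + 1) := by
  have h := Multiset.filter_add_not (0 < ·) (Finset.univ.val.map c)
  have h₀ : (Multiset.filter (fun i => ¬ 0 < i) (Finset.univ.val.map c)).sum = 0 := by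
    apply Multiset.sum_eq_zero
    simp
  rw [partialSum_eq_sum_univ, Finset.sum, ← h, Multiset.sum_add, h₀, add_zero, contentType]

end Content

section Rearrangement

theorem exists_comp_perm_eq_of_map_univ_eq {m : ℕ} {f g : Fin m → ℕ}
    (h : Finset.univ.val.map f = Finset.univ.val.map g) : ∃ σ : Equiv.Perm (Fin m), g ∘ σ = f := by
  have key : f ∘ Tuple.sort f = g ∘ Tuple.sort g := by
    apply List.ofFn_injective
    refine List.Perm.eq_of_sortedLE (Tuple.monotone_sort f).sortedLE_ofFn
      (Tuple.monotone_sort g).sortedLE_ofFn ?_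
    refine (Equiv.Perm.ofFn_comp_perm _ f).trans
      (List.Perm.trans ?_ (Equiv.Perm.ofFn_comp_perm _ g).symm)
    simpa using h
  refine ⟨(Tuple.sort f).symm.trans (Tuple.sort g), ?_⟩
  funext x
  simpa using (congrFun key ((Tuple.sort f).symm x)).symm

theorem ncard_map_univ_eq {m : ℕ} {M : Multiset ℕ} (hM : Multiset.card M = m) :
    {f : Fin m → ℕ | Finset.univ.val.map f = M}.ncard * mfac M = m.factorial := by
  obtain ⟨f, hf⟩ : ∃ f : Fin m → ℕ, Finset.univ.val.map f = M := by
    subst hM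
    refine ⟨fun i => M.toList.get (Fin.cast (by simp) i), ?_⟩
    have : (List.ofFn fun i : Fin (Multiset.card M) => M.toList.get (Fin.cast (by simp) i))
        = M.toList := by
      apply List.ext_get <;> simp
    rw [Fin.univ_val_map, this, Multiset.coe_toList]
  have horbit : MulAction.orbit (Equiv.Perm (Fin m))ᵈᵐᵃ f =
      {f : Fin m → ℕ | Finset.univ.val.map f = M} := by
    ext g
    simp only [MulAction.mem_orbit_iff, Set.mem_ofPred_eq]
    constructor
    · rintro ⟨σ, rfl⟩
      rw [← hf]
      have : (σ • f : Fin m → ℕ) = f ∘ (DomMulAct.mk.symm σ : Equiv.Perm (Fin m)) := rfl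
      rw [this, ← Multiset.map_map, Multiset.map_univ_val_equiv]
    · intro hg
      obtain ⟨σ, hσ⟩ := exists_comp_perm_eq_of_map_univ_eq (hg.trans hf.symm)
      exact ⟨DomMulAct.mk σ, hσ⟩
  have hstab : Nat.card (MulAction.stabilizer (Equiv.Perm (Fin m))ᵈᵐᵃ f) = mfac M := by
    have h₁ := DomMulAct.stabilizer_card' (f := f)
    rw [← Nat.card_eq_fintype_card] at h₁
    rw [Nat.card_congr (Equiv.subtypeEquiv DomMulAct.mk.symm
      (q := fun g : Equiv.Perm (Fin m) => f ∘ g = f)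
      fun _ => DomMulAct.mem_stabilizer_iff), h₁, mfac]
    have himg : M.toFinset = Finset.univ.image f := by
      rw [← hf]; rfl
    rw [himg]
    refine Finset.prod_congr rfl fun i _ => ?_
    rw [← hf, Multiset.count_map, Fintype.card_subtype]
    simp only [eq_comm, Finset.card_def, Finset.filter_val]
  rw [← horbit, ← MulAction.index_stabilizer, ← hstab, mul_comm, Subgroup.card_mul_index,
    Nat.card_congr DomMulAct.mk.symm, Nat.card_perm, Nat.card_fin]

end Rearrangement

section CycleLemma

variable {n : ℕ}

theorem partialSum_add (c : Fin (n + 1) → ℕ) (r : Fin (n + 1)) (k : ℕ) :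
    partialSum c (r + k) = partialSum c r + partialSum (fun i => c (i + r)) k := by
  rw [partialSum, Finset.sum_range_add, partialSum, partialSum]
  congr 1
  refine Finset.sum_congr rfl fun i _ => congrArg c ?_
  ext
  simp [Fin.val_add, add_comm]

theorem partialSum_add_period (c : Fin (n + 1) → ℕ) (k : ℕ) :
    partialSum c (n + 1 + k) = partialSum c (n + 1) + partialSum c k := by
  rw [partialSum, Finset.sum_range_add, partialSum, partialSum]
  congr 1
  refine Finset.sum_congr rfl fun i _ => congrArg c ?_
  ext
  simp

theorem partialSum_rotate_total (c : Fin (n + 1) → ℕ) (r : Fin (n + 1)) :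
    partialSum (fun i => c (i + r)) (n + 1) = partialSum c (n + 1) := by
  rw [partialSum_eq_sum_univ, partialSum_eq_sum_univ]
  exact Equiv.sum_comp (Equiv.addRight r) c

theorem contentType_rotate (c : Fin (n + 1) → ℕ) (r : Fin (n + 1)) :
    contentType (fun i => c (i + r)) = contentType c := by
  have : (fun i => c (i + r)) = c ∘ Equiv.addRight r := rfl
  rw [contentType, this, ← Multiset.map_map, Multiset.map_univ_val_equiv, contentType]

theorem isBallot_rotate_iff {c : Fin (n + 1) → ℕ} (hc : partialSum c (n + 1) = n)
    (r : Fin (n + 1)) :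
    IsBallot (fun i => c (i + r)) ↔ ∀ k ≤ n, partialSum c r + k ≤ partialSum c (r + k) := by
  rw [IsBallot, partialSum_rotate_total, hc]
  simp only [partialSum_add, add_le_add_iff_left, true_and]

/-- The cycle lemma. -/
theorem existsUnique_isBallot_rotate {c : Fin (n + 1) → ℕ} (hc : partialSum c (n + 1) = n) :
    ∃! r : Fin (n + 1), IsBallot (fun i => c (i + r)) := by
  simp only [isBallot_rotate_iff hc]
  have hper := partialSum_add_period c
  rw [hc] at hper
  refine existsUnique_of_exists_of_unique ?_ ?_
  · let S : Fin (n + 1) → ℤ := fun k => partialSum c k - k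
    obtain ⟨r₀, hr₀⟩ := Finite.exists_min S
    have hex : ∃ r : ℕ, ∃ h : r < n + 1, ∀ k, S ⟨r, h⟩ ≤ S k := ⟨r₀, r₀.2, hr₀⟩
    classical
    obtain ⟨hr, hmin⟩ := Nat.find_spec hex
    refine ⟨⟨Nat.find hex, hr⟩, fun k hk => ?_⟩
    have hfirst := fun m (hm : m < Nat.find hex) => Nat.find_min hex hm
    generalize Nat.find hex = r at *
    simp only [S] at hmin hfirst
    by_cases hrk : r + k < n + 1
    · have := hmin ⟨r + k, hrk⟩
      push_cast at this ⊢
      omega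
    · obtain ⟨m, hm⟩ : ∃ m, r + k = n + 1 + m := ⟨r + k - (n + 1), by omega⟩
      have hm' : m < r := by omega
      have h₁ := hfirst m hm'
      push Not at h₁
      obtain ⟨j, hj⟩ := h₁ (by omega)
      have h₂ := hmin j
      have h₃ := hper m
      simp only [hm, h₃]
      omega
  · have key : ∀ r s : Fin (n + 1), r < s →
        (∀ k ≤ n, partialSum c r + k ≤ partialSum c (r + k)) →
        (∀ k ≤ n, partialSum c s + k ≤ partialSum c (s + k)) → False := by
      intro r s hrs hr hs
      have h₁ := hr (s - r) (by omega)
      have h₂ := hs (n + 1 + r - s) (by omega)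
      rw [show r.1 + (s.1 - r.1) = s by omega] at h₁
      rw [show s.1 + (n + 1 + r.1 - s.1) = n + 1 + r by omega, hper] at h₂
      omega
    intro r s hr hs
    rcases lt_trichotomy r s with h | h | h
    · exact (key r s h hr hs).elim
    · exact h
    · exact (key s r h hs hr).elim

theorem mul_ncard_isBallot {lam : Multiset ℕ} (hsum : lam.sum = n) :
    (n + 1) * {c : Fin (n + 1) → ℕ | IsBallot c ∧ contentType c = lam}.ncard =
      {c : Fin (n + 1) → ℕ | contentType c = lam}.ncard := by
  have htot : ∀ c : Fin (n + 1) → ℕ, contentType c = lam → partialSum c (n + 1) = n := by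
    rintro c rfl
    rw [← sum_contentType, hsum]
  have hbij : Set.BijOn (fun p : Fin (n + 1) × (Fin (n + 1) → ℕ) => fun i => p.2 (i - p.1))
      (Set.univ ×ˢ {c : Fin (n + 1) → ℕ | IsBallot c ∧ contentType c = lam})
      {c : Fin (n + 1) → ℕ | contentType c = lam} := by
    refine ⟨?_, ?_, ?_⟩
    · rintro ⟨r, c⟩ ⟨-, -, hc⟩
      simpa [← sub_eq_add_neg] using (contentType_rotate c (-r)).trans hc
    · rintro ⟨r, c⟩ ⟨-, hb, hc⟩ ⟨s, d⟩ ⟨-, hb', hd⟩ h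
      have hc' : (fun i => (fun i => c (i - r)) (i + r)) = c := by simp
      have hd' : (fun i => (fun i => c (i - r)) (i + s)) = d := by
        funext i
        simpa using congrFun h (i + s)
      have ht : contentType (fun i => c (i - r)) = lam := by
        simpa [← sub_eq_add_neg] using (contentType_rotate c (-r)).trans hc
      obtain rfl : r = s := (existsUnique_isBallot_rotate (htot _ ht)).unique
        (by rw [hc']; exact hb) (by rw [hd']; exact hb')
      rw [Prod.mk.injEq, ← hc', ← hd']
      exact ⟨rfl, rfl⟩
    · intro c hc
      obtain ⟨r, hr, -⟩ := existsUnique_isBallot_rotate (htot c hc)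
      exact ⟨(r, fun i => c (i + r)), ⟨trivial, hr, (contentType_rotate c r).trans hc⟩, by simp⟩
  rw [← hbij.ncard_eq, Set.ncard_prod, Set.ncard_univ, Nat.card_fin]

theorem card_le_sum_of_pos {lam : Multiset ℕ} (hpos : ∀ i ∈ lam, 0 < i) :
    Multiset.card lam ≤ lam.sum := by
  have := Multiset.card_nsmul_le_sum (a := 1) hpos
  simpa using this

theorem ncard_contentType_eq {lam : Multiset ℕ} (hsum : lam.sum = n)
    (hpos : ∀ i ∈ lam, 0 < i) :
    {c : Fin (n + 1) → ℕ | contentType c = lam}.ncard *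
      (mfac lam * (n + 1 - Multiset.card lam).factorial) = (n + 1).factorial := by
  have hle := card_le_sum_of_pos hpos
  set z := n + 1 - Multiset.card lam with hz
  have hzero : 0 ∉ lam := fun h => (hpos 0 h).ne rfl
  have hset : {c : Fin (n + 1) → ℕ | contentType c = lam} =
      {c : Fin (n + 1) → ℕ | Finset.univ.val.map c = lam + Multiset.replicate z 0} := by
    ext c
    simp only [Set.mem_ofPred_eq, contentType]
    constructor
    · intro h
      rw [← Multiset.filter_add_not (0 < ·) (Finset.univ.val.map c), h]
      congr 1
      refine Multiset.eq_replicate.2 ⟨?_, ?_⟩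
      · have := congrArg Multiset.card
          (Multiset.filter_add_not (0 < ·) (Finset.univ.val.map c))
        rw [h, Multiset.card_add, Multiset.card_map, Finset.card_val, Finset.card_univ,
          Fintype.card_fin] at this
        omega
      · simp
    · intro h
      rw [h, Multiset.filter_add, Multiset.filter_eq_self.2 hpos, Multiset.filter_eq_nil.2,
        add_zero]
      intro a ha
      simp [Multiset.eq_of_mem_replicate ha]
  have hmfac : mfac (lam + Multiset.replicate z 0) = mfac lam * z.factorial := by
    have hz0 : z ≠ 0 := by omega
    rw [mfac, Multiset.toFinset_add, Multiset.toFinset_replicate, if_neg hz0,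
      Finset.prod_union (by simpa using hzero), Finset.prod_singleton, mfac]
    congr 1
    · refine Finset.prod_congr rfl fun i hi => ?_
      have hi0 : i ≠ 0 := fun h => hzero (by simpa [h] using hi)
      rw [Multiset.count_add, Multiset.count_replicate, if_neg hi0.symm, add_zero]
    · rw [Multiset.count_add, Multiset.count_eq_zero.2 hzero, Multiset.count_replicate_self,
        zero_add]
  rw [hset, ← hmfac, ncard_map_univ_eq]
  rw [Multiset.card_add, Multiset.card_replicate]
  omega

theorem ncard_isBallot {lam : Multiset ℕ} (hsum : lam.sum = n) (hpos : ∀ i ∈ lam, 0 < i) :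
    {c : Fin (n + 1) → ℕ | IsBallot c ∧ contentType c = lam}.ncard =
      n.factorial / (mfac lam * (n + 1 - Multiset.card lam).factorial) := by
  have h := ncard_contentType_eq hsum hpos
  rw [← mul_ncard_isBallot hsum, Nat.factorial_succ, mul_assoc] at h
  have h' := Nat.eq_of_mul_eq_mul_left (Nat.succ_pos n) h
  rw [← h', Nat.mul_div_cancel]
  exact Nat.pos_of_ne_zero fun h0 => n.factorial_ne_zero (by rw [← h', h0, mul_zero])

end CycleLemma

section Primitive

variable {n : ℕ}

theorem exists_monotone_content_eq {c : Fin (n + 1) → ℕ} (hc : partialSum c (n + 1) = n) :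
    ∃ g : Fin n → ℕ, Monotone g ∧ (∀ j, g j ≤ n) ∧ content g = c := by
  classical
  have hex : ∀ j : Fin n, ∃ i, j < partialSum c (i + 1) := fun j => ⟨n, by omega⟩
  have hlt : ∀ j a, Nat.find (hex j) < a ↔ j < partialSum c a := by
    intro j a
    rw [Nat.find_lt_iff]
    constructor
    · rintro ⟨m, hm, hj⟩
      exact hj.trans_le (partialSum_mono c hm)
    · intro h
      cases a with
      | zero => simp [partialSum] at h
      | succ a => exact ⟨a, Nat.lt_succ_self a, h⟩
  refine ⟨fun j => Nat.find (hex j), ?_, ?_, ?_⟩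
  · intro j k hjk
    refine Nat.find_mono fun i hi => ?_
    exact lt_of_le_of_lt hjk hi
  · intro j
    exact Nat.find_le (by omega)
  · refine eq_of_partialSum_eq fun k hk => ?_
    rw [partialSum_content _ hk]
    simp only [hlt, Fin.card_filter_val_lt]
    exact min_eq_right ((partialSum_mono c hk).trans_eq hc)

theorem eq_of_monotone_of_content_eq {f g : Fin n → ℕ} (hf : Monotone f) (hg : Monotone g)
    (hfn : ∀ j, f j ≤ n) (hgn : ∀ j, g j ≤ n) (h : content f = content g) : f = g := by
  have hlt : ∀ j a, a ≤ n + 1 → (f j < a ↔ g j < a) := by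
    intro j a ha
    rw [← Tuple.lt_card_lt_iff_apply_lt_of_monotone hf,
      ← Tuple.lt_card_lt_iff_apply_lt_of_monotone hg, ← partialSum_content f ha,
      ← partialSum_content g ha, h]
  funext j
  have h₁ := hlt j (f j + 1) (by have := hfn j; omega)
  have h₂ := hlt j (g j + 1) (by have := hgn j; omega)
  omega

theorem le_of_isBallot_content {g : Fin n → ℕ} (hg : Monotone g) (h : IsBallot (content g))
    (j : Fin n) : g j ≤ j := by
  have h₁ := h.2 (j + 1) (by omega)
  rw [partialSum_content g (by omega)] at h₁
  have := (Tuple.lt_card_lt_iff_apply_lt_of_monotone (a := j.1 + 1) (j := j) hg).1 (by omega)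
  omega

theorem isParkingFunction_iff_of_monotone {f : Fin n → ℕ} (hf : Monotone f) :
    IsParkingFunction n f ↔ ∀ j, 1 ≤ f j ∧ f j ≤ j.1 + 1 := by
  constructor
  · rintro ⟨σ, hσ, h⟩ j
    have key : f ∘ σ = f ∘ (1 : Equiv.Perm (Fin n)) := Tuple.unique_monotone hσ hf
    have hj : f (σ j) = f j := congrFun key j
    rw [← hj]
    exact h j
  · exact fun h => ⟨1, hf, h⟩

theorem contentType_eq_pfType {f : Fin n → ℕ} (hf : ∀ j, 1 ≤ f j ∧ f j ≤ n) :
    contentType (content fun j => f j - 1) = pfType n f := by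
  have h₁ : Finset.univ.val.map (content fun j => f j - 1) =
      (Multiset.range (n + 1)).map
        fun i => (Finset.univ.filter fun j => f j = i + 1).card := by
    rw [Fin.univ_val_map, ← Multiset.coe_range, Multiset.map_coe, List.ofFn_eq_map,
      ← List.map_coe_finRange_eq_range, List.map_map]
    congr 1
    refine List.map_congr_left fun i _ => ?_
    simp only [content, Function.comp]
    congr 1
    ext j
    have := hf j
    simp only [Finset.mem_filter, Finset.mem_univ, true_and]
    omega
  have h₂ : (Finset.Icc 1 n).val = (Multiset.range n).map (· + 1) := by
    have : Finset.Icc 1 n = (Finset.range n).map (addRightEmbedding 1) := by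
      ext i
      simp only [Finset.mem_Icc, Finset.mem_map, Finset.mem_range, addRightEmbedding_apply]
      exact ⟨fun h => ⟨i - 1, by omega, by omega⟩, by rintro ⟨a, h, rfl⟩; omega⟩
    rw [this]
    rfl
  have h₃ : (Finset.univ.filter fun j => f j = n + 1).card = 0 := by
    rw [Finset.card_eq_zero, Finset.filter_eq_empty_iff]
    intro j _
    have := hf j
    omega
  rw [contentType, h₁, pfType, h₂, Multiset.map_map, Multiset.range_succ, Multiset.map_cons,
    Multiset.filter_cons_of_neg _ (by rw [h₃]; exact lt_irrefl 0)]
  rfl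

theorem ncard_primitive (lam : Multiset ℕ) :
    {f : Fin n → ℕ | Monotone f ∧ IsParkingFunction n f ∧ pfType n f = lam}.ncard =
      {c : Fin (n + 1) → ℕ | IsBallot c ∧ contentType c = lam}.ncard := by
  refine Set.BijOn.ncard_eq (f := fun f => content fun j => f j - 1) ⟨?_, ?_, ?_⟩
  · rintro f ⟨hf, hp, hl⟩
    rw [isParkingFunction_iff_of_monotone hf] at hp
    refine ⟨isBallot_content fun j => ?_, (contentType_eq_pfType fun j => ?_).trans hl⟩
    · have := hp j
      omega
    · have := hp j
      omega
  · rintro f ⟨hf, hp, -⟩ g ⟨hg, hp', -⟩ h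
    rw [isParkingFunction_iff_of_monotone hf] at hp
    rw [isParkingFunction_iff_of_monotone hg] at hp'
    have := eq_of_monotone_of_content_eq (fun i j hij => Nat.sub_le_sub_right (hf hij) 1)
      (fun i j hij => Nat.sub_le_sub_right (hg hij) 1)
      (fun j => by have := hp j; omega) (fun j => by have := hp' j; omega) h
    funext j
    have h₁ := congrFun this j
    have h₂ := hp j
    have h₃ := hp' j
    omega
  · rintro c ⟨hc, hl⟩
    obtain ⟨g, hg, -, rfl⟩ := exists_monotone_content_eq hc.1
    have hle := le_of_isBallot_content hg hc
    have hmono : Monotone fun j => g j + 1 := fun i j hij => Nat.add_le_add_right (hg hij) 1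
    refine ⟨fun j => g j + 1, ⟨hmono, ?_, ?_⟩, by simp⟩
    · rw [isParkingFunction_iff_of_monotone hmono]
      intro j
      have := hle j
      omega
    · rw [← contentType_eq_pfType fun j => ⟨by omega, by have := hle j; omega⟩]
      simpa using hl

end Primitive

section Noncrossing

variable {n : ℕ}

/-- The excess of the first `k` entries of `c` over `k`. -/
def height (c : Fin (n + 1) → ℕ) (k : ℕ) : ℤ := partialSum c k - k

theorem height_succ (c : Fin (n + 1) → ℕ) (i : Fin (n + 1)) :
    height c (i + 1) = height c i + c i - 1 := by
  rw [height, height, partialSum_succ, Fin.ofNat_val_eq_self]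
  push_cast
  ring

/-- `b j` is the last position up to `j` at which `h` is at most `h (j + 1)`. -/
def IsLastBelow (h : ℕ → ℤ) (b : Fin n → Fin n) : Prop :=
  ∀ j, b j ≤ j ∧ h (b j) ≤ h (j + 1) ∧ ∀ k : ℕ, b j < k → k ≤ j → h (j + 1) < h k

theorem IsLastBelow.eq_of {h : ℕ → ℤ} {b : Fin n → Fin n} (hb : IsLastBelow h b)
    {i j : Fin n} (hij : i ≤ j) (hi : h i ≤ h (j + 1))
    (hk : ∀ k : ℕ, i < k → k ≤ j → h (j + 1) < h k) : b j = i := by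
  obtain ⟨h₁, h₂, h₃⟩ := hb j
  rcases lt_trichotomy (b j) i with hlt | heq | hlt
  · exact absurd (h₃ i hlt hij) (not_lt.2 hi)
  · exact heq
  · exact absurd (hk (b j) hlt h₁) (not_lt.2 h₂)

theorem IsLastBelow.unique {h : ℕ → ℤ} {b b' : Fin n → Fin n} (hb : IsLastBelow h b)
    (hb' : IsLastBelow h b') : b = b' :=
  funext fun j => hb.eq_of (hb' j).1 (hb' j).2.1 (hb' j).2.2

theorem exists_isLastBelow {h : ℕ → ℤ} (h₀ : h 0 = 0) (hnonneg : ∀ k ≤ n, 0 ≤ h k) :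
    ∃ b : Fin n → Fin n, IsLastBelow h b := by
  have hex : ∀ j : Fin n, ∃ i : Fin n, i ≤ j ∧ h i ≤ h (j + 1) ∧
      ∀ k : ℕ, i < k → k ≤ j → h (j + 1) < h k := by
    intro j
    let s := (Finset.univ : Finset (Fin n)).filter fun i => i ≤ j ∧ h i ≤ h (j + 1)
    have hs : s.Nonempty := by
      refine ⟨⟨0, j.pos⟩, ?_⟩
      simp only [s, Finset.mem_filter, Finset.mem_univ, true_and, h₀]
      exact ⟨Nat.zero_le _, hnonneg _ j.2⟩
    have hmem := s.max'_mem hs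
    simp only [s, Finset.mem_filter, Finset.mem_univ, true_and] at hmem
    refine ⟨s.max' hs, hmem.1, hmem.2, fun k hk hkj => ?_⟩
    by_contra hcon
    have hks : (⟨k, by omega⟩ : Fin n) ∈ s := by
      simp only [s, Finset.mem_filter, Finset.mem_univ, true_and]
      exact ⟨hkj, not_lt.1 hcon⟩
    exact absurd (s.le_max' _ hks) (not_le.2 hk)
  choose b hb using hex
  exact ⟨b, hb⟩

/-- `b` sends every element to the least element of its block, for some noncrossing
partition. -/
structure IsNoncrossingMin (b : Fin n → Fin n) : Prop where
  le : ∀ j, b j ≤ j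
  idem : ∀ j, b (b j) = b j
  noncrossing : ∀ x y, b x < b y → b y < x → x < y → False

theorem IsLastBelow.isNoncrossingMin {h : ℕ → ℤ} {b : Fin n → Fin n} (hb : IsLastBelow h b) :
    IsNoncrossingMin b where
  le j := (hb j).1
  idem j := by
    obtain ⟨h₁, h₂, h₃⟩ := hb j
    obtain ⟨h₄, h₅, h₆⟩ := hb (b j)
    rcases h₁.eq_or_lt with heq | hlt
    · rw [heq, heq]
    · rcases h₄.eq_or_lt with heq' | hlt'
      · exact heq'
      · have := h₃ (b j + 1) (Nat.lt_succ_self _) hlt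
        have := h₆ (b j) hlt' le_rfl
        omega
  noncrossing x y h₁ h₂ h₃ := by
    have h₄ := (hb x).2.2 (b y) h₁ h₂.le
    have h₅ := (hb y).2.1
    have h₆ := (hb y).2.2 (x + 1) (by omega) h₃
    omega

theorem height_content {b : Fin n → Fin n} (hb : ∀ j, b j ≤ j) {k : ℕ} (hk : k ≤ n) :
    height (content fun j => (b j : ℕ)) k =
      (Finset.univ.filter fun j : Fin n => k ≤ j ∧ (b j : ℕ) < k).card := by
  have h₁ : (Finset.univ.filter fun j : Fin n => (b j : ℕ) < k) =
      (Finset.univ.filter fun j : Fin n => k ≤ j ∧ (b j : ℕ) < k) ∪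
        Finset.univ.filter fun j : Fin n => j.1 < k := by
    ext j
    have := hb j
    simp only [Finset.mem_filter, Finset.mem_univ, true_and, Finset.mem_union]
    omega
  have h₂ : Disjoint (Finset.univ.filter fun j : Fin n => k ≤ j ∧ (b j : ℕ) < k)
      (Finset.univ.filter fun j : Fin n => j.1 < k) := by
    rw [Finset.disjoint_left]
    intro j
    simp only [Finset.mem_filter, Finset.mem_univ, true_and]
    omega
  rw [height, partialSum_content _ (by omega), h₁, Finset.card_union_of_disjoint h₂,
    Fin.card_filter_val_lt, min_eq_right hk]
  push_cast
  ring

theorem IsNoncrossingMin.isLastBelow {b : Fin n → Fin n} (hb : IsNoncrossingMin b) :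
    IsLastBelow (height (content fun j => (b j : ℕ))) b := by
  intro j
  have hle := hb.le j
  refine ⟨hle, ?_, fun k hk hkj => ?_⟩
  · rw [height_content hb.le (by omega), height_content hb.le (by omega), Nat.cast_le]
    refine Finset.card_le_card fun x => ?_
    simp only [Finset.mem_filter, Finset.mem_univ, true_and]
    rintro ⟨h₁, h₂⟩
    refine ⟨?_, by omega⟩
    by_contra hcon
    have hne : x ≠ b j := by
      rintro rfl
      rw [hb.idem] at h₂
      omega
    have hne' : x ≠ j := by
      rintro rfl
      omega
    exact hb.noncrossing x j (by omega) (by omega) (by omega)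
  · rw [height_content hb.le (by omega), height_content hb.le (by omega), Nat.cast_lt]
    refine Finset.card_lt_card (Finset.ssubset_iff_of_subset ?_ |>.2 ⟨j, ?_, ?_⟩)
    · intro x
      simp only [Finset.mem_filter, Finset.mem_univ, true_and]
      rintro ⟨h₁, h₂⟩
      refine ⟨by omega, ?_⟩
      by_contra hcon
      have hne : b x ≠ j := by
        intro h
        have := hb.idem x
        rw [h] at this
        omega
      exact hb.noncrossing j x (by omega) (by omega) (by omega)
    · simp only [Finset.mem_filter, Finset.mem_univ, true_and]
      omega
    · simp

theorem IsLastBelow.content_eq {c : Fin (n + 1) → ℕ} (hc : IsBallot c) {b : Fin n → Fin n}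
    (hb : IsLastBelow (height c) b) : content (fun j => (b j : ℕ)) = c := by
  funext i
  have hn := hc.partialSum_self
  have hheight : height c n = 0 := by rw [height, hn, sub_self]
  by_cases hi : i.1 < n
  swap
  · obtain rfl : i = Fin.last n := by
      ext
      rw [Fin.val_last]
      omega
    have h₁ := height_succ c (Fin.last n)
    rw [Fin.val_last, hheight, height, hc.1] at h₁
    have h₂ : content (fun j => (b j : ℕ)) (Fin.last n) = 0 := by
      rw [content, Finset.card_eq_zero, Finset.filter_eq_empty_iff]
      intro j _
      rw [Fin.val_last]
      omega
    push_cast at h₁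
    omega
  have hnonneg : 0 ≤ height c i := by
    have := hc.2 i hi.le
    rw [height]
    omega
  have hcard : c i = (Finset.Ico (height c i) (height c i + c i)).card := by simp
  have hstep := height_succ c i
  rw [content, hcard]
  refine Finset.card_bij (fun j _ => height c (j + 1)) ?_ ?_ ?_
  · intro j hj
    simp only [Finset.mem_filter, Finset.mem_univ, true_and] at hj
    obtain ⟨h₁, h₂, h₃⟩ := hb j
    rw [hj] at h₂
    rw [Finset.mem_Ico]
    refine ⟨h₂, ?_⟩
    by_cases hij : i.1 = j
    · rw [← hij]
      omega
    · have := h₃ (i + 1) (by omega) (by omega)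
      omega
  · have key : ∀ j j' : Fin n, (b j : ℕ) = i → (b j' : ℕ) = i →
        height c (j + 1) = height c (j' + 1) → ¬ j < j' := by
      intro j j' hj hj' h hlt
      have h₁ := (hb j).1
      have := (hb j').2.2 (j + 1) (by omega) (by omega)
      omega
    intro j hj j' hj' h
    simp only [Finset.mem_filter, Finset.mem_univ, true_and] at hj hj'
    exact le_antisymm (not_lt.1 (key j' j hj' hj h.symm)) (not_lt.1 (key j j' hj hj' h))
  · intro l hl
    rw [Finset.mem_Ico] at hl
    have hex : ∃ j, i.1 ≤ j ∧ j < n ∧ height c (j + 1) ≤ l := by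
      refine ⟨n - 1, by omega, by omega, ?_⟩
      rw [show n - 1 + 1 = n by omega, hheight]
      omega
    classical
    obtain ⟨h₁, h₂, h₃⟩ := Nat.find_spec hex
    have hmin := fun m (hm : m < Nat.find hex) => Nat.find_min hex hm
    generalize Nat.find hex = j at *
    have hgt : ∀ k : ℕ, i < k → k ≤ j → l < height c k := by
      intro k hk hkj
      have := hmin (k - 1) (by omega)
      rw [show k - 1 + 1 = k by omega] at this
      by_contra hcon
      exact this ⟨by omega, by omega, not_lt.1 hcon⟩
    have heq : height c (j + 1) = l := by
      refine le_antisymm h₃ ?_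
      rcases h₁.eq_or_lt with hij | hij
      · subst hij
        omega
      · have := hgt j hij le_rfl
        have : height c (j + 1) = height c j + c ⟨j, by omega⟩ - 1 := height_succ c ⟨j, by omega⟩
        omega
    refine ⟨⟨j, h₂⟩, ?_, heq⟩
    simp only [Finset.mem_filter, Finset.mem_univ, true_and]
    have := hb.eq_of (i := ⟨i, hi⟩) (j := ⟨j, h₂⟩) h₁ (by simp only [heq]; omega)
      (fun k hk hkj => by simpa only [heq] using hgt k hk hkj)
    rw [this]

end Noncrossing

section BlockMin

variable {n : ℕ}

/-- The least element of the block containing `j`. -/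
def blockMin (P : Finpartition (Finset.univ : Finset (Fin n))) (j : Fin n) : Fin n :=
  (P.part j).min' ⟨j, P.mem_part (Finset.mem_univ j)⟩

variable {P : Finpartition (Finset.univ : Finset (Fin n))}

theorem blockMin_mem (P : Finpartition (Finset.univ : Finset (Fin n))) (j : Fin n) :
    blockMin P j ∈ P.part j :=
  Finset.min'_mem _ _

theorem blockMin_le (P : Finpartition (Finset.univ : Finset (Fin n))) {i j : Fin n}
    (h : i ∈ P.part j) : blockMin P j ≤ i :=
  Finset.min'_le _ _ h

theorem part_blockMin (P : Finpartition (Finset.univ : Finset (Fin n))) (j : Fin n) :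
    P.part (blockMin P j) = P.part j :=
  P.part_eq_of_mem (P.part_mem.2 (Finset.mem_univ j)) (blockMin_mem P j)

theorem blockMin_eq_iff {i j : Fin n} : blockMin P i = blockMin P j ↔ P.part i = P.part j := by
  constructor
  · intro h
    rw [← part_blockMin P i, h, part_blockMin]
  · intro h
    simp only [blockMin, h]

theorem mem_part_iff_blockMin {i j : Fin n} : i ∈ P.part j ↔ blockMin P i = blockMin P j := by
  rw [blockMin_eq_iff, P.mem_part_iff_part_eq_part (Finset.mem_univ i) (Finset.mem_univ j)]

theorem parts_eq_image_part (P : Finpartition (Finset.univ : Finset (Fin n))) :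
    P.parts = Finset.univ.image P.part := by
  ext B
  simp only [Finset.mem_image, Finset.mem_univ, true_and]
  constructor
  · intro hB
    obtain ⟨j, hj⟩ := P.nonempty_of_mem_parts hB
    exact ⟨j, P.part_eq_of_mem hB hj⟩
  · rintro ⟨j, rfl⟩
    exact P.part_mem.2 (Finset.mem_univ j)

theorem blockMin_injective :
    Function.Injective (blockMin : Finpartition (Finset.univ : Finset (Fin n)) → _) := by
  intro P Q h
  have hpart : P.part = Q.part := by
    funext j
    ext i
    rw [mem_part_iff_blockMin, mem_part_iff_blockMin, h]
  ext1
  rw [parts_eq_image_part, parts_eq_image_part, hpart]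

theorem isNoncrossingMin_blockMin (hP : IsNoncrossing P) : IsNoncrossingMin (blockMin P) where
  le j := blockMin_le P (P.mem_part (Finset.mem_univ j))
  idem j := by rw [blockMin_eq_iff, part_blockMin]
  noncrossing x y h₁ h₂ h₃ := hP ⟨blockMin P x, blockMin P y, x, y, P.part x, P.part y, h₁, h₂,
    h₃, P.part_mem.2 (Finset.mem_univ x), P.part_mem.2 (Finset.mem_univ y),
    fun h => h₁.ne (blockMin_eq_iff.2 h), blockMin_mem P x, P.mem_part (Finset.mem_univ x),
    blockMin_mem P y, P.mem_part (Finset.mem_univ y)⟩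

theorem isNoncrossing_of_blockMin (hP : IsNoncrossingMin (blockMin P)) : IsNoncrossing P := by
  rintro ⟨a, b, c, d, B, B', hab, hbc, hcd, hB, hB', hne, ha, hc, hb, hd⟩
  have hpa := P.part_eq_of_mem hB ha
  have hpb := P.part_eq_of_mem hB' hb
  have hpc := P.part_eq_of_mem hB hc
  have hpd := P.part_eq_of_mem hB' hd
  have hac : blockMin P a = blockMin P c := blockMin_eq_iff.2 (hpa.trans hpc.symm)
  have hbd : blockMin P b = blockMin P d := blockMin_eq_iff.2 (hpb.trans hpd.symm)
  rcases lt_trichotomy (blockMin P a) (blockMin P b) with h | h | h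
  · have := hP.le b
    exact hP.noncrossing c d (by rwa [← hac, ← hbd]) (by rw [← hbd]; omega) hcd
  · exact hne (by rw [← hpa, ← hpb, blockMin_eq_iff.1 h])
  · have := hP.le a
    exact hP.noncrossing b c (by rwa [← hac]) (by rw [← hac]; omega) hbc

theorem exists_blockMin_eq {b : Fin n → Fin n} (hle : ∀ j, b j ≤ j)
    (hidem : ∀ j, b (b j) = b j) :
    ∃ P : Finpartition (Finset.univ : Finset (Fin n)), blockMin P = b := by
  classical
  have hrel : ∀ i j : Fin n, i ∈ (Finpartition.ofSetoid (Setoid.ker b)).part j ↔ b j = b i :=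
    fun i j => Finpartition.mem_part_ofSetoid_iff_rel
  refine ⟨Finpartition.ofSetoid (Setoid.ker b), funext fun j => le_antisymm ?_ ?_⟩
  · exact blockMin_le _ ((hrel _ _).2 (hidem j).symm)
  · rw [(hrel _ _).1 (blockMin_mem (Finpartition.ofSetoid (Setoid.ker b)) j)]
    exact hle _

theorem contentType_blockMin (P : Finpartition (Finset.univ : Finset (Fin n))) :
    contentType (content fun j => (blockMin P j : ℕ)) = P.parts.val.map Finset.card := by
  set c := content fun j => (blockMin P j : ℕ) with hc
  let B : Fin (n + 1) → Finset (Fin n) :=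
    fun i => Finset.univ.filter fun j => (blockMin P j : ℕ) = i
  have hB : ∀ j, B (blockMin P j).castSucc = P.part j := by
    intro j
    ext i
    simp [B, mem_part_iff_blockMin, Fin.val_inj]
  have hpos : ∀ i, 0 < c i ↔ ∃ j, (blockMin P j).castSucc = i := by
    intro i
    simp [hc, content, Finset.card_pos, Finset.Nonempty, Fin.ext_iff]
  have hparts : P.parts = (Finset.univ.filter fun i => 0 < c i).image B := by
    rw [parts_eq_image_part]
    ext s
    simp only [Finset.mem_image, Finset.mem_filter, Finset.mem_univ, true_and, hpos]
    constructor
    · rintro ⟨j, rfl⟩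
      exact ⟨_, ⟨j, rfl⟩, hB j⟩
    · rintro ⟨_, ⟨j, rfl⟩, rfl⟩
      exact ⟨j, (hB j).symm⟩
  have hinj : Set.InjOn B (Finset.univ.filter fun i => 0 < c i : Finset (Fin (n + 1))) := by
    intro i hi i' hi' h
    simp only [Finset.coe_filter, Finset.mem_univ, true_and, Set.mem_ofPred_eq, hpos] at hi hi'
    obtain ⟨j, rfl⟩ := hi
    obtain ⟨j', rfl⟩ := hi'
    rw [hB, hB] at h
    rw [blockMin_eq_iff.2 h]
  rw [hparts, Finset.image_val_of_injOn hinj, Multiset.map_map, contentType,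
    Multiset.filter_map, Finset.filter_val]
  rfl

theorem ncard_noncrossing (lam : Multiset ℕ) :
    {P : Finpartition (Finset.univ : Finset (Fin n)) |
        IsNoncrossing P ∧ P.parts.val.map Finset.card = lam}.ncard =
      {c : Fin (n + 1) → ℕ | IsBallot c ∧ contentType c = lam}.ncard := by
  refine Set.BijOn.ncard_eq (f := fun P => content fun j => (blockMin P j : ℕ)) ⟨?_, ?_, ?_⟩
  · rintro P ⟨hP, hl⟩
    exact ⟨isBallot_content (isNoncrossingMin_blockMin hP).le,
      (contentType_blockMin P).trans hl⟩
  · rintro P ⟨hP, -⟩ Q ⟨hQ, -⟩ h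
    have hP' := (isNoncrossingMin_blockMin hP).isLastBelow
    have hQ' := (isNoncrossingMin_blockMin hQ).isLastBelow
    simp only at h
    rw [h] at hP'
    exact blockMin_injective (hP'.unique hQ')
  · rintro c ⟨hc, hl⟩
    obtain ⟨b, hb⟩ := exists_isLastBelow (n := n) (h := height c) (by simp [height, partialSum])
      fun k hk => by
        have := hc.2 k hk
        rw [height]
        omega
    have hmin := hb.isNoncrossingMin
    obtain ⟨P, rfl⟩ := exists_blockMin_eq hmin.le hmin.idem
    have hcontent := hb.content_eq hc
    exact ⟨P, ⟨isNoncrossing_of_blockMin hmin, by rw [← contentType_blockMin, hcontent, hl]⟩,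
      hcontent⟩

end BlockMin

/-- The number of primitive parking functions of length `n` of type `λ ⊢ n` equals the
number of noncrossing partitions of `{1, …, n}` of type `λ`, namely
`n!/(m_λ·(n+1-ℓ(λ))!)`. -/
theorem stmt_18 (n : ℕ) (lam : Multiset ℕ) (hsum : lam.sum = n) (hpos : ∀ i ∈ lam, 0 < i) :
    {f : Fin n → ℕ | Monotone f ∧ IsParkingFunction n f ∧ pfType n f = lam}.ncard =
      {P : Finpartition (Finset.univ : Finset (Fin n)) |
        IsNoncrossing P ∧ P.parts.val.map Finset.card = lam}.ncard ∧
    {f : Fin n → ℕ | Monotone f ∧ IsParkingFunction n f ∧ pfType n f = lam}.ncard =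
      n.factorial / (mfac lam * (n + 1 - Multiset.card lam).factorial) := by
  rw [ncard_noncrossing, ncard_primitive]
  exact ⟨rfl, ncard_isBallot hsum hpos⟩
end
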